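/- arXiv:2501.02358 — 2 statements merged into one kernel-verified Lean document; each statement's English description precedes it below -/
import Mathlib

section
/- Let q ∈ ℕ, q ≥ 1, m ∈ {0,1,…,q}, and η ∈ ℝ, and let P_l, d_l be as in the three-term recurrence. Let (a,b) be an open interval containing all the zeros of P_q, and set η_b = P_{q+1}(b)/P_q(b). Let λ_{q+1} < ⋯ < λ_1 be the zeros of P̃_{q+1}(λ) = P_{q+1}(λ) − η P_q(λ), and let a_0,…,a_{q−m} be the (unique) real coefficients in the expansion P̃_{q+1}(λ)/((λ−λ_1)⋯(λ−λ_{m+1})) = Σ_{l=0}^{q−m} d_l a_l P_l(λ). Then: (a) if either m ≥ 1 and η ∈ ℝ, or m = 0 and η < η_b, then a_0/P_0(b) > a_1/P_1(b) > ⋯ > a_{q−m}/P_{q−m}(b) > 0; (b) if m = 0 and η = η_b, then a_0/P_0(b) = a_1/P_1(b) = ⋯ = a_q/P_q(b) > 0; (c) if m = 0 and η > η_b, then 0 < a_0/P_0(b) < a_1/P_1(b) < ⋯ < a_q/P_q(b). -/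
namespace DiscPaper

open Polynomial in
/-- STATEMENT SETUP: the polynomials `P_l` generated by the three-term recurrence
`γ_{l-1} P_{l-1} + α_l P_l + β_l P_{l+1} = λ ρ_l P_l` with `P_{-1} = 0`, `P_0 = 1`. -/
structure Recurrence (α β γ ρ : ℕ → ℝ) (P : ℕ → Polynomial ℝ) : Prop where
  hβ : ∀ l, 0 < β l
  hγ : ∀ l, 0 < γ l
  hρ : ∀ l, 0 < ρ l
  hP0 : P 0 = 1
  hrec0 : C (α 0) * P 0 + C (β 0) * P 1 = X * (C (ρ 0) * P 0)
  hrec : ∀ l : ℕ,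
    C (γ l) * P l + C (α (l + 1)) * P (l + 1) + C (β (l + 1)) * P (l + 2) =
      X * (C (ρ (l + 1)) * P (l + 1))

/-- STATEMENT SETUP: `Λ (k-1)` is the `k`-th zero `λ_k` of
`P̃_{q+1} = P_{q+1} - η P_q`, ordered decreasingly: `λ_{q+1} < ⋯ < λ_1`. -/
structure SLZeros (P : ℕ → Polynomial ℝ) (q : ℕ) (η : ℝ) (Λ : ℕ → ℝ) : Prop where
  anti : StrictAntiOn Λ (Set.Iic q)
  root : ∀ i ≤ q, (P (q + 1) - Polynomial.C η * P q).eval (Λ i) = 0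

/-- Christoffel-Darboux kernel. -/
noncomputable def Ker (d : ℕ → ℝ) (P : ℕ → ℝ → ℝ) (l : ℕ) (x y : ℝ) : ℝ :=
  ∑ k ∈ Finset.range (l + 1), d k * P k x * P k y

lemma Ker_succ (d : ℕ → ℝ) (P : ℕ → ℝ → ℝ) (l : ℕ) (x y : ℝ) :
    Ker d P (l + 1) x y = Ker d P l x y + d (l + 1) * P (l + 1) x * P (l + 1) y := by
  unfold Ker
  rw [Finset.sum_range_succ]

lemma Ker_zero (d : ℕ → ℝ) (P : ℕ → ℝ → ℝ) (x y : ℝ) :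
    Ker d P 0 x y = d 0 * P 0 x * P 0 y := by
  simp [Ker]

lemma Ker_comm (d : ℕ → ℝ) (P : ℕ → ℝ → ℝ) (l : ℕ) (x y : ℝ) :
    Ker d P l x y = Ker d P l y x := by
  unfold Ker
  exact Finset.sum_congr rfl fun k _ => by ring

/-- Finite system of functions with a Christoffel-Darboux formula. -/
structure Sys (q : ℕ) (P : ℕ → ℝ → ℝ) (d κ : ℕ → ℝ) : Prop where
  hd : ∀ l ≤ q, 0 < d l
  hκ : ∀ l ≤ q, 0 < κ l
  h0 : ∀ x, 0 < P 0 x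
  cont : ∀ l ≤ q, Continuous (P l)
  ev : ∀ l ≤ q, ∀ᶠ x in Filter.atTop, 0 < P l x
  cd : ∀ l ≤ q, ∀ x y, κ l * (P (l + 1) x * P l y - P l x * P (l + 1) y) =
    (x - y) * Ker d P l x y

lemma Ker_pos {d : ℕ → ℝ} {P : ℕ → ℝ → ℝ} {l : ℕ} {x y : ℝ} (h0 : ∀ x, 0 < P 0 x)
    (hd : ∀ k ≤ l, 0 < d k) (hx : ∀ k ≤ l, 0 ≤ P k x) (hy : ∀ k ≤ l, 0 ≤ P k y) :
    0 < Ker d P l x y := by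
  unfold Ker
  apply Finset.sum_pos'
  · intro k hk
    have hk' : k ≤ l := by simpa [Nat.lt_succ_iff] using hk
    exact mul_nonneg (mul_nonneg (hd k hk').le (hx k hk')) (hy k hk')
  · exact ⟨0, by simp, mul_pos (mul_pos (hd 0 (Nat.zero_le _)) (h0 x)) (h0 y)⟩

lemma Sys.dichotomy {q : ℕ} {P : ℕ → ℝ → ℝ} {d κ : ℕ → ℝ} (S : Sys q P d κ) (B : ℝ) :
    (∀ l ≤ q, ∀ x ≥ B, 0 < P l x) ∨ ∃ x ≥ B, P q x = 0 ∧ P (q + 1) x < 0 := by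
  by_contra hcon
  push Not at hcon
  obtain ⟨⟨l₁, hl₁, x₁, hx₁, hn⟩, hno⟩ := hcon
  have hev : ∀ᶠ x in Filter.atTop, ∀ l ∈ Finset.range (q + 1), 0 < P l x := by
    rw [Filter.eventually_all_finset]
    intro l hl
    exact S.ev l (by simpa [Nat.lt_succ_iff] using hl)
  obtain ⟨M, hM⟩ := Filter.eventually_atTop.1 hev
  let T : Set ℝ := Set.Icc B M ∩ ⋃ l ∈ Finset.range (q + 1), {x | P l x ≤ 0}
  have hTc : IsCompact T := by
    apply isCompact_Icc.inter_right
    apply Set.Finite.isClosed_biUnion (Finset.finite_toSet _)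
    intro l hl
    exact isClosed_le (S.cont l (by simpa [Nat.lt_succ_iff] using hl)) continuous_const
  have hTmem : ∀ x ≥ B, ∀ l ≤ q, P l x ≤ 0 → x ∈ T := by
    intro x hx l hl h
    refine ⟨⟨hx, ?_⟩, ?_⟩
    · by_contra hc
      exact absurd (hM x (le_of_not_ge hc) l (by simpa [Nat.lt_succ_iff] using hl)) (not_lt.2 h)
    · simp only [Set.mem_iUnion]
      exact ⟨l, by simpa [Nat.lt_succ_iff] using hl, h⟩
  obtain ⟨x₀, hx₀T, hx₀⟩ := hTc.exists_isGreatest ⟨x₁, hTmem x₁ hx₁ l₁ hl₁ hn⟩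
  have hB : B ≤ x₀ := hx₀T.1.1
  have hgt : ∀ x > x₀, ∀ l ≤ q, 0 < P l x := by
    intro x hx l hl
    by_contra hc
    exact absurd (hx₀ (hTmem x (hB.trans hx.le) l hl (not_lt.1 hc))) (not_le.2 hx)
  have hge : ∀ l ≤ q, 0 ≤ P l x₀ := by
    intro l hl
    have h1 : Filter.Tendsto (P l) (nhdsWithin x₀ (Set.Ioi x₀)) (nhds (P l x₀)) :=
      ((S.cont l hl).tendsto x₀).mono_left nhdsWithin_le_nhds
    refine ge_of_tendsto h1 ?_
    filter_upwards [self_mem_nhdsWithin] with x hx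
    exact (hgt x hx l hl).le
  obtain ⟨l, hl, hle⟩ : ∃ l ≤ q, P l x₀ ≤ 0 := by
    have := hx₀T.2
    simp only [Set.mem_iUnion] at this
    obtain ⟨l, hl, h⟩ := this
    exact ⟨l, by simpa [Nat.lt_succ_iff] using hl, h⟩
  have hz : P l x₀ = 0 := le_antisymm hle (hge l hl)
  have hcd := S.cd l hl (x₀ + 1) x₀
  have hK : 0 < Ker d P l (x₀ + 1) x₀ := Ker_pos S.h0 (fun k hk => S.hd k (hk.trans hl))
    (fun k hk => (hgt _ (by linarith) k (hk.trans hl)).le) (fun k hk => hge k (hk.trans hl))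
  have hp := hgt (x₀ + 1) (by linarith) l hl
  have hκ := S.hκ l hl
  have hneg : P (l + 1) x₀ < 0 := by
    by_contra hc
    push Not at hc
    rw [hz] at hcd
    have : 0 ≤ κ l * (P l (x₀ + 1) * P (l + 1) x₀) := by positivity
    nlinarith
  rcases hl.lt_or_eq with h | h
  · exact absurd (hge (l + 1) h) (not_le.2 hneg)
  · subst h
    exact absurd (hno x₀ hB hz) (not_le.2 hneg)

section star
variable {q : ℕ} {P : ℕ → ℝ → ℝ} {d κ : ℕ → ℝ} {μ : ℝ}

noncomputable def dst (P : ℕ → ℝ → ℝ) (κ : ℕ → ℝ) (μ : ℝ) (l : ℕ) : ℝ :=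
  1 / (κ l * P l μ * P (l + 1) μ)

noncomputable def kst (P : ℕ → ℝ → ℝ) (d : ℕ → ℝ) (μ : ℝ) (l : ℕ) : ℝ :=
  1 / (d (l + 1) * P (l + 1) μ ^ 2)

noncomputable def Pst (P : ℕ → ℝ → ℝ) (d : ℕ → ℝ) (μ : ℝ) (l : ℕ) (x : ℝ) : ℝ :=
  Ker d P l x μ

lemma star_id0 (S : Sys q P d κ) (hp : ∀ l ≤ q, 0 < P l μ) (y : ℝ) (l : ℕ) (hl : l + 1 ≤ q) :
    (y - μ) * (dst P κ μ l * Pst P d μ l y) = P (l + 1) y / P (l + 1) μ - P l y / P l μ := by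
  have h1 := S.cd l (by omega) y μ
  have h2 := hp l (by omega)
  have h3 := hp (l + 1) hl
  have h4 := S.hκ l (by omega)
  have : (y - μ) * (dst P κ μ l * Pst P d μ l y) = dst P κ μ l * ((y - μ) * Ker d P l y μ) := by
    unfold Pst; ring
  rw [this, ← h1]
  unfold dst
  field_simp

/-- `K_{l+1}(x,y) + (y-μ) K*_l(x,y) = (P_{l+1}(y)/P_{l+1}(μ)) K_{l+1}(x,μ)`. -/
lemma star_id1 (S : Sys q P d κ) (hp : ∀ l ≤ q, 0 < P l μ) (x y : ℝ) (l : ℕ)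
    (hl : l + 1 ≤ q) :
    Ker d P (l + 1) x y + (y - μ) * Ker (dst P κ μ) (Pst P d μ) l x y =
      P (l + 1) y / P (l + 1) μ * Pst P d μ (l + 1) x := by
  induction l with
  | zero =>
    have h := star_id0 S hp y 0 hl
    have h2 := hp 0 (by omega)
    have h3 := hp 1 hl
    have e : Ker d P 0 x y = P 0 y / P 0 μ * Pst P d μ 0 x := by
      unfold Pst
      rw [Ker_zero, Ker_zero]
      field_simp
    have e2 : Pst P d μ (0 + 1) x = Pst P d μ 0 x + d (0 + 1) * P (0 + 1) x * P (0 + 1) μ :=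
      Ker_succ ..
    rw [Ker_succ, e, Ker_zero, e2]
    have : (y - μ) * (dst P κ μ 0 * Pst P d μ 0 x * Pst P d μ 0 y) =
      (P (0 + 1) y / P (0 + 1) μ - P 0 y / P 0 μ) * Pst P d μ 0 x := by rw [← h]; ring
    rw [this]
    field_simp
    ring
  | succ l ih =>
    have ih := ih (by omega)
    have h := star_id0 S hp y (l + 1) hl
    have h2 := hp (l + 1) (by omega)
    have h3 := hp (l + 1 + 1) hl
    have e2 : Pst P d μ (l + 1 + 1) x =
        Pst P d μ (l + 1) x + d (l + 1 + 1) * P (l + 1 + 1) x * P (l + 1 + 1) μ :=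
      Ker_succ ..
    rw [Ker_succ, Ker_succ (dst P κ μ), e2]
    have h4 : (y - μ) * (dst P κ μ (l + 1) * Pst P d μ (l + 1) x * Pst P d μ (l + 1) y) =
      (P (l + 1 + 1) y / P (l + 1 + 1) μ - P (l + 1) y / P (l + 1) μ) * Pst P d μ (l + 1) x := by
        rw [← h]; ring
    have h5 : P (l + 1 + 1) y / P (l + 1 + 1) μ * (d (l + 1 + 1) * P (l + 1 + 1) x * P (l + 1 + 1) μ)
      = d (l + 1 + 1) * P (l + 1 + 1) x * P (l + 1 + 1) y := by field_simp
    linear_combination ih + h4 - h5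

lemma star_sys {q : ℕ} (S : Sys (q + 1) P d κ) (hp : ∀ l ≤ q + 1, 0 < P l μ) :
    Sys q (Pst P d μ) (dst P κ μ) (kst P d μ) where
  hd l hl := by
    have h2 := hp l (by omega)
    have h3 := hp (l + 1) (by omega)
    have h4 := S.hκ l (by omega)
    unfold dst; positivity
  hκ l hl := by
    have h3 := hp (l + 1) (by omega)
    have h4 := S.hd (l + 1) (by omega)
    unfold kst; positivity
  h0 x := by
    have h2 := hp 0 (by omega)
    have h4 := S.hd 0 (by omega)
    have h5 := S.h0 x
    unfold Pst; rw [Ker_zero]; positivity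
  cont l hl := by
    unfold Pst Ker
    apply continuous_finsetSum
    intro k hk
    have : k ≤ l := by simpa [Nat.lt_succ_iff] using hk
    exact ((continuous_const.mul (S.cont k (by omega))).mul continuous_const)
  ev l hl := by
    have hev : ∀ᶠ x in Filter.atTop, ∀ k ∈ Finset.range (l + 1), 0 < P k x := by
      rw [Filter.eventually_all_finset]
      intro k hk
      have : k ≤ l := by simpa [Nat.lt_succ_iff] using hk
      exact S.ev k (by omega)
    filter_upwards [hev] with x hx
    exact Ker_pos S.h0 (fun k hk => S.hd k (by omega))
      (fun k hk => (hx k (by simpa [Nat.lt_succ_iff] using hk)).le) (fun k hk => (hp k (by omega)).le)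
  cd l hl x y := by
    have h1 := star_id1 S hp x y l (by omega)
    have h2 := star_id1 S hp y x l (by omega)
    rw [Ker_comm d P _ y x, Ker_comm (dst P κ μ) _ _ y x] at h2
    have h3 := hp (l + 1) (by omega)
    have h4 := S.hd (l + 1) (by omega)
    have e : ∀ x, Pst P d μ (l + 1) x =
        Pst P d μ l x + d (l + 1) * P (l + 1) x * P (l + 1) μ := fun x => Ker_succ ..
    have : (x - y) * Ker (dst P κ μ) (Pst P d μ) l x y =
      P (l + 1) x / P (l + 1) μ * Pst P d μ (l + 1) y -
      P (l + 1) y / P (l + 1) μ * Pst P d μ (l + 1) x := by linear_combination h2 - h1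
    rw [this, e, e]
    unfold kst
    field_simp
    ring

/-- coefficient in the kernel expansion -/
noncomputable def cst (P : ℕ → ℝ → ℝ) (d κ : ℕ → ℝ) (μ B : ℝ) (k : ℕ) : ℝ :=
  Pst P d μ k B / (κ k * P k B * P (k + 1) B)

lemma star_kernel (S : Sys q P d κ) (hp : ∀ l ≤ q, 0 < P l μ) (x B : ℝ)
    (hB : ∀ l ≤ q, 0 < P l B) (l : ℕ) (hl : l + 1 ≤ q) :
    Ker (dst P κ μ) (Pst P d μ) l x B = P (l + 1) B / P (l + 1) μ *
      ∑ k ∈ Finset.range (l + 1), cst P d κ μ B k * Ker d P k x B := by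
  induction l with
  | zero =>
    have h1 := hp 0 (by omega)
    have h2 := hp 1 hl
    have h3 := hB 0 (by omega)
    have h4 := hB 1 hl
    have h5 := S.hκ 0 (by omega)
    simp only [Ker_zero, zero_add, Finset.range_one, Finset.sum_singleton, cst, dst, Pst]
    field_simp
  | succ l ih =>
    have ih := ih (by omega)
    have id1 := star_id1 S hp x B l (by omega)
    have id0 := star_id0 S hp B (l + 1) hl
    have h1 := hp (l + 1) (by omega)
    have h2 := hp (l + 1 + 1) hl
    have h3 := hB (l + 1) (by omega)
    have h4 := hB (l + 1 + 1) hl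
    have h5 := S.hκ (l + 1) (by omega)
    rw [Finset.sum_range_succ, mul_add, Ker_succ]
    have e : ∑ k ∈ Finset.range (l + 1), cst P d κ μ B k * Ker d P k x B =
      P (l + 1) μ / P (l + 1) B * Ker (dst P κ μ) (Pst P d μ) l x B := by
      rw [ih]; field_simp
    rw [e]
    have e3 : Ker d P (l + 1) x B = P (l + 1) B / P (l + 1) μ * Pst P d μ (l + 1) x -
      (B - μ) * Ker (dst P κ μ) (Pst P d μ) l x B := by linear_combination id1
    rw [e3]
    set Z := Ker (dst P κ μ) (Pst P d μ) l x B
    have e4 : P (l + 1 + 1) B / P (l + 1 + 1) μ =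
      P (l + 1) B / P (l + 1) μ + (B - μ) * (dst P κ μ (l + 1) * Pst P d μ (l + 1) B) := by
      linear_combination -id0
    have e5 : P (l + 1 + 1) B / P (l + 1 + 1) μ * cst P d κ μ B (l + 1) =
      dst P κ μ (l + 1) * Pst P d μ (l + 1) B * (P (l + 1) μ / P (l + 1) B) := by
      unfold cst dst; field_simp
    have e6 : P (l + 1) μ / P (l + 1) B * (P (l + 1) B / P (l + 1) μ) = 1 := by field_simp
    linear_combination (-(P (l + 1) μ / P (l + 1) B) * Z) * e4 -
      (P (l + 1) B / P (l + 1) μ * Pst P d μ (l + 1) x - (B - μ) * Z) * e5 -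
      (Z + dst P κ μ (l + 1) * Pst P d μ (l + 1) B * Pst P d μ (l + 1) x) * e6

end star

/-- The largest zero lies to the right of all zeros of `P_q`. -/
lemma pos_top {q : ℕ} {P : ℕ → ℝ → ℝ} {d κ : ℕ → ℝ} (S : Sys q P d κ) {Λ : ℕ → ℝ} {η c : ℝ}
    (hc : 0 < c) (hΛ : StrictAntiOn Λ (Set.Iic q))
    (hfac : ∀ x, P (q + 1) x - η * P q x = c * ∏ j ∈ Finset.range (q + 1), (x - Λ j)) :
    ∀ l ≤ q, ∀ x ≥ Λ 0, 0 < P l x := by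
  rcases S.dichotomy (Λ 0) with h | ⟨x, hx, h0, h1⟩
  · exact h
  · exfalso
    have h2 := hfac x
    rw [h0] at h2
    have : 0 ≤ ∏ j ∈ Finset.range (q + 1), (x - Λ j) := by
      apply Finset.prod_nonneg
      intro j hj
      have hj' : j ≤ q := by simpa [Nat.lt_succ_iff] using hj
      have := hΛ.antitoneOn (Set.mem_Iic.2 (Nat.zero_le q)) (Set.mem_Iic.2 hj') (Nat.zero_le j)
      linarith
    have := mul_nonneg hc.le this
    linarith

lemma Pst_fac {q : ℕ} {P : ℕ → ℝ → ℝ} {d κ : ℕ → ℝ} (S : Sys q P d κ) {Λ : ℕ → ℝ} {η c : ℝ}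
    (hfac : ∀ x, P (q + 1) x - η * P q x = c * ∏ j ∈ Finset.range (q + 1), (x - Λ j)) (x : ℝ) :
    Pst P d (Λ 0) q x = κ q * P q (Λ 0) * c * ∏ j ∈ Finset.range q, (x - Λ (j + 1)) := by
  have hcont : Continuous (Pst P d (Λ 0) q) := by
    unfold Pst Ker
    apply continuous_finsetSum
    intro k hk
    have : k ≤ q := by simpa [Nat.lt_succ_iff] using hk
    exact ((continuous_const.mul (S.cont k this)).mul continuous_const)
  have hr : P (q + 1) (Λ 0) - η * P q (Λ 0) = 0 := by
    rw [hfac, Finset.prod_range_succ']; simp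
  have : Pst P d (Λ 0) q =
      fun x => κ q * P q (Λ 0) * c * ∏ j ∈ Finset.range q, (x - Λ (j + 1)) := by
    refine hcont.ext_on (dense_compl_singleton (Λ 0)) (by fun_prop) ?_
    intro y hy
    have hy' : y - Λ 0 ≠ 0 := sub_ne_zero.2 hy
    have h1 := S.cd q le_rfl y (Λ 0)
    have h2 := hfac y
    rw [Finset.prod_range_succ'] at h2
    apply mul_left_cancel₀ hy'
    unfold Pst
    rw [← h1]
    linear_combination κ q * P q (Λ 0) * h2 - κ q * P q y * hr
  rw [this]

theorem main_cone : ∀ (m q : ℕ) (P : ℕ → ℝ → ℝ) (d κ Λ : ℕ → ℝ) (η c B : ℝ), Sys q P d κ → m ≤ q →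
    0 < c → StrictAntiOn Λ (Set.Iic q) →
    (∀ x, P (q + 1) x - η * P q x = c * ∏ j ∈ Finset.range (q + 1), (x - Λ j)) →
    (∀ l ≤ q, ∀ x ≥ B, 0 < P l x) → (m = 0 → Λ 0 < B) →
    ∃ t : ℕ → ℝ, (∀ l ≤ q - m, 0 < t l) ∧
      ∀ x, c * ∏ j ∈ Finset.range (q - m), (x - Λ (m + 1 + j)) =
        ∑ l ∈ Finset.range (q - m + 1), t l * Ker d P l x B := by
  intro m
  induction m with
  | zero =>
    intro q P d κ Λ η c B S hm hc hΛ hfac hB hlt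
    have hlt := hlt rfl
    have hp : ∀ l ≤ q, 0 < P l (Λ 0) := fun l hl => pos_top S hc hΛ hfac l hl _ le_rfl
    have hb : ∀ l ≤ q, 0 < P l B := fun l hl => hB l hl B le_rfl
    have hκ := S.hκ q le_rfl
    have hpq := hp q le_rfl
    have hprod : ∀ x, c * ∏ j ∈ Finset.range (q - 0), (x - Λ (0 + 1 + j)) =
        1 / (κ q * P q (Λ 0)) * Pst P d (Λ 0) q x := by
      intro x
      rw [Pst_fac S hfac x]
      field_simp
      simp [add_comm]
    simp only [hprod]
    cases q with
    | zero =>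
      refine ⟨fun _ => 1 / (κ 0 * P 0 (Λ 0)) * (P 0 (Λ 0) / P 0 B), fun l _ => ?_, fun x => ?_⟩
      · have := hb 0 le_rfl
        positivity
      · have := hb 0 le_rfl
        simp only [Pst, Ker_zero, Nat.sub_zero, zero_add, Finset.range_one, Finset.sum_singleton]
        field_simp
    | succ q =>
      have hbq := hb (q + 1) le_rfl
      refine ⟨fun l => if l = q + 1 then 1 / (κ (q + 1) * P (q + 1) (Λ 0)) *
        (P (q + 1) (Λ 0) / P (q + 1) B) else 1 / (κ (q + 1) * P (q + 1) (Λ 0)) *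
        ((B - Λ 0) * cst P d κ (Λ 0) B l), fun l hl => ?_, fun x => ?_⟩
      · simp only
        split_ifs with h
        · positivity
        · have hl' : l + 1 ≤ q + 1 := by omega
          have h1 : 0 < Pst P d (Λ 0) l B := Ker_pos S.h0 (fun k hk => S.hd k (by omega))
            (fun k hk => (hb k (by omega)).le) (fun k hk => (hp k (by omega)).le)
          have h2 := hb l (by omega)
          have h3 := hb (l + 1) hl'
          have h4 := S.hκ l (by omega)
          have h5 : 0 < B - Λ 0 := by linarith
          unfold cst
          positivity
      · have id1 := star_id1 S hp x B q le_rfl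
        have sk := star_kernel S hp x B hb q le_rfl
        rw [Nat.sub_zero, Finset.sum_range_succ]
        beta_reduce
        rw [if_pos rfl]
        have : ∑ l ∈ Finset.range (q + 1), (if l = q + 1 then 1 / (κ (q + 1) * P (q + 1) (Λ 0)) *
          (P (q + 1) (Λ 0) / P (q + 1) B) else 1 / (κ (q + 1) * P (q + 1) (Λ 0)) *
          ((B - Λ 0) * cst P d κ (Λ 0) B l)) * Ker d P l x B =
          1 / (κ (q + 1) * P (q + 1) (Λ 0)) * (B - Λ 0) *
            ∑ l ∈ Finset.range (q + 1), cst P d κ (Λ 0) B l * Ker d P l x B := by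
          rw [Finset.mul_sum]
          apply Finset.sum_congr rfl
          intro l hl
          have : l ≠ q + 1 := by have := Finset.mem_range.1 hl; omega
          rw [if_neg this]; ring
        rw [this]
        set W := ∑ l ∈ Finset.range (q + 1), cst P d κ (Λ 0) B l * Ker d P l x B
        rw [sk] at id1
        have e : Pst P d (Λ 0) (q + 1) x = P (q + 1) (Λ 0) / P (q + 1) B *
          (P (q + 1) B / P (q + 1) (Λ 0) * Pst P d (Λ 0) (q + 1) x) := by field_simp
        rw [e, ← id1]
        field_simp
        ring
  | succ m ih =>
    intro q' P d κ Λ η c B S hm hc hΛ hfac hB _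
    obtain ⟨q, rfl⟩ : ∃ q, q' = q + 1 := ⟨q' - 1, by omega⟩
    have hp : ∀ l ≤ q + 1, 0 < P l (Λ 0) := fun l hl => pos_top S hc hΛ hfac l hl _ le_rfl
    have hb : ∀ l ≤ q + 1, 0 < P l B := fun l hl => hB l hl B le_rfl
    have hκ := S.hκ (q + 1) le_rfl
    have hpq := hp (q + 1) le_rfl
    have S' := star_sys S hp
    have hpos : ∀ l ≤ q + 1, ∀ x ≥ B, 0 < Pst P d (Λ 0) l x := fun l hl x hx =>
      Ker_pos S.h0 (fun k hk => S.hd k (by omega))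
            (fun k hk => (hB k (by omega) x hx).le) (fun k hk => (hp k (by omega)).le)
    have hfac' := Pst_fac S hfac
    obtain ⟨t, ht, hteq⟩ := ih q (Pst P d (Λ 0)) (dst P κ (Λ 0)) (kst P d (Λ 0)) (fun i => Λ (i + 1)) 0
      (κ (q + 1) * P (q + 1) (Λ 0) * c) B S' (by omega) (by positivity)
      (fun i hi j hj hij => hΛ (by simpa using hi) (by simpa using hj) (by omega))
      (fun x => by rw [hfac' x]; ring)
      (fun l hl => hpos l (by omega))
      (fun _ => by
        by_contra hc'
        have h1 := hpos (q + 1) le_rfl (Λ 1) (not_lt.1 hc')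
        rw [hfac' (Λ 1), Finset.prod_range_succ'] at h1
        simp at h1)
    have hsub : q + 1 - (m + 1) = q - m := by omega
    rw [hsub]
    set n := q - m with hn
    have hnq : n ≤ q := by omega
    let τ : ℕ → ℕ → ℝ := fun l k => if k ≤ l then
      P (l + 1) B / P (l + 1) (Λ 0) * cst P d κ (Λ 0) B k else 0
    have hcst : ∀ k ≤ q, 0 < cst P d κ (Λ 0) B k := by
      intro k hk
      have h1 := hpos k (by omega) B le_rfl
      have h2 := hb k (by omega)
      have h3 := hb (k + 1) (by omega)
      have h4 := S.hκ k (by omega)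
      unfold cst
      positivity
    have hτ : ∀ l ≤ q, ∀ k ≤ l, 0 < τ l k := by
      intro l hl k hk
      have h1 := hcst k (by omega)
      have h2 := hp (l + 1) (by omega)
      have h3 := hb (l + 1) (by omega)
      simp only [τ, if_pos hk]
      positivity
    have hker : ∀ x, ∀ l ≤ n, Ker (dst P κ (Λ 0)) (Pst P d (Λ 0)) l x B =
        ∑ k ∈ Finset.range (n + 1), τ l k * Ker d P k x B := by
      intro x l hl
      rw [star_kernel S hp x B hb l (by omega), Finset.mul_sum]
      rw [← Finset.sum_subset (Finset.range_mono (show l + 1 ≤ n + 1 by omega))]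
      · apply Finset.sum_congr rfl
        intro k hk
        have : k ≤ l := by simpa [Nat.lt_succ_iff] using hk
        simp only [τ, if_pos this]; ring
      · intro k _ hk
        have : ¬ k ≤ l := by simpa [Nat.lt_succ_iff] using hk
        simp [τ, this]
    refine ⟨fun k => 1 / (κ (q + 1) * P (q + 1) (Λ 0)) * ∑ l ∈ Finset.range (n + 1), t l * τ l k,
      fun k hk => ?_, fun x => ?_⟩
    · have : 0 < ∑ l ∈ Finset.range (n + 1), t l * τ l k := by
        apply Finset.sum_pos'
        · intro l hl
          have hl' : l ≤ n := by simpa [Nat.lt_succ_iff] using hl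
          by_cases h : k ≤ l
          · exact (mul_pos (ht l hl') (hτ l (by omega) k h)).le
          · simp [τ, h]
        · exact ⟨k, by simpa [Nat.lt_succ_iff] using hk, mul_pos (ht k hk) (hτ k (by omega) k le_rfl)⟩
      positivity
    · have h1 := hteq x
      have h2 : ∑ l ∈ Finset.range (n + 1), t l * Ker (dst P κ (Λ 0)) (Pst P d (Λ 0)) l x B =
        ∑ k ∈ Finset.range (n + 1), (∑ l ∈ Finset.range (n + 1), t l * τ l k) * Ker d P k x B := by
        simp only [Finset.sum_mul]
        rw [Finset.sum_comm]
        apply Finset.sum_congr rfl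
        intro l hl
        rw [hker x l (by simpa [Nat.lt_succ_iff] using hl), Finset.mul_sum]
        exact Finset.sum_congr rfl fun k _ => by ring
      rw [h2] at h1
      have h3 : ∑ k ∈ Finset.range (n + 1), 1 / (κ (q + 1) * P (q + 1) (Λ 0)) *
          (∑ l ∈ Finset.range (n + 1), t l * τ l k) * Ker d P k x B =
          1 / (κ (q + 1) * P (q + 1) (Λ 0)) * ∑ k ∈ Finset.range (n + 1),
          (∑ l ∈ Finset.range (n + 1), t l * τ l k) * Ker d P k x B := by
        rw [Finset.mul_sum]
        exact Finset.sum_congr rfl fun k _ => by ring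
      rw [h3, ← h1]
      have h4 : ∀ j, m + 1 + 1 + j = m + 1 + j + 1 := fun j => by omega
      simp only [h4]
      field_simp

/-- degrees and leading coefficients -/
lemma rec_deg {α β γ ρ : ℕ → ℝ} {P : ℕ → Polynomial ℝ} (hP : Recurrence α β γ ρ P) (l : ℕ) :
    (P l).natDegree ≤ l ∧ 0 < (P l).coeff l := by
  have key : ∀ l, ((P l).natDegree ≤ l ∧ 0 < (P l).coeff l) ∧
      ((P (l + 1)).natDegree ≤ l + 1 ∧ 0 < (P (l + 1)).coeff (l + 1)) := by
    have solve : ∀ (b r : ℝ) (n : ℕ) (U V R : Polynomial ℝ), 0 < b → 0 < r →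
        R + Polynomial.C b * U = Polynomial.X * (Polynomial.C r * V) → R.natDegree ≤ n →
        V.natDegree ≤ n → 0 < V.coeff n → U.natDegree ≤ n + 1 ∧ 0 < U.coeff (n + 1) := by
      intro b r n U V R hb hr h hR hV hVc
      have hc : ∀ k, R.coeff (k + 1) + b * U.coeff (k + 1) = r * V.coeff k := by
        intro k
        have := congrArg (fun p => Polynomial.coeff p (k + 1)) h
        simpa using this
      constructor
      · rw [Polynomial.natDegree_le_iff_coeff_eq_zero]
        intro N hN
        obtain ⟨k, rfl⟩ : ∃ k, N = k + 1 := ⟨N - 1, by omega⟩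
        have h1 := hc k
        rw [Polynomial.coeff_eq_zero_of_natDegree_lt (show R.natDegree < k + 1 by omega),
          Polynomial.coeff_eq_zero_of_natDegree_lt (show V.natDegree < k by omega)] at h1
        have : b * U.coeff (k + 1) = 0 := by linarith
        exact (mul_eq_zero.1 this).resolve_left hb.ne'
      · have h1 := hc n
        rw [Polynomial.coeff_eq_zero_of_natDegree_lt (show R.natDegree < n + 1 by omega)] at h1
        have h2 : 0 < b * U.coeff (n + 1) := by
          have := mul_pos hr hVc
          linarith
        exact (mul_pos_iff_of_pos_left hb).1 h2
    intro l
    induction l with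
    | zero =>
      have h0 : (P 0).natDegree ≤ 0 ∧ 0 < (P 0).coeff 0 := by rw [hP.hP0]; simp
      refine ⟨h0, solve (β 0) (ρ 0) 0 (P 1) (P 0) (Polynomial.C (α 0) * P 0) (hP.hβ 0) (hP.hρ 0) hP.hrec0
        ?_ h0.1 h0.2⟩
      exact (Polynomial.natDegree_C_mul_le _ _).trans h0.1
    | succ l ih =>
      refine ⟨ih.2, solve _ _ (l + 1) _ _ _ (hP.hβ (l + 1)) (hP.hρ (l + 1)) (hP.hrec l) ?_ ih.2.1 ih.2.2⟩
      refine (Polynomial.natDegree_add_le _ _).trans (max_le ?_ ?_)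
      · exact (Polynomial.natDegree_C_mul_le _ _).trans (ih.1.1.trans (by omega))
      · exact (Polynomial.natDegree_C_mul_le _ _).trans ih.2.1
  exact (key l).1

lemma coeffs_unique {P : ℕ → Polynomial ℝ} (hdeg : ∀ l, (P l).natDegree ≤ l ∧ 0 < (P l).coeff l)
    (N : ℕ) (u v : ℕ → ℝ)
    (h : ∑ l ∈ Finset.range N, Polynomial.C (u l) * P l =
      ∑ l ∈ Finset.range N, Polynomial.C (v l) * P l) : ∀ l < N, u l = v l := by
  induction N with
  | zero => intro l hl; omega
  | succ N ih =>
    have h0 : ∀ w : ℕ → ℝ, (∑ l ∈ Finset.range N, Polynomial.C (w l) * P l).coeff N = 0 := by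
      intro w
      rw [Polynomial.finsetSum_coeff]
      apply Finset.sum_eq_zero
      intro l hl
      have hl := Finset.mem_range.1 hl
      rw [Polynomial.coeff_C_mul, Polynomial.coeff_eq_zero_of_natDegree_lt
        (lt_of_le_of_lt (hdeg l).1 hl), mul_zero]
    rw [Finset.sum_range_succ, Finset.sum_range_succ] at h
    have hN : u N = v N := by
      have := congrArg (fun p => Polynomial.coeff p N) h
      simp only [Polynomial.coeff_add, h0, Polynomial.coeff_C_mul, zero_add] at this
      exact mul_right_cancel₀ (hdeg N).2.ne' this
    rw [hN] at h
    have := ih (add_right_cancel h)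
    intro l hl
    rcases Nat.lt_succ_iff_lt_or_eq.1 hl with h' | h'
    · exact this l h'
    · rw [h', hN]

lemma rec_sys {α β γ ρ : ℕ → ℝ} {P : ℕ → Polynomial ℝ} (hP : Recurrence α β γ ρ P)
    {d : ℕ → ℝ}
    (hd : ∀ l, d l = ρ l * (∏ i ∈ Finset.range l, β i) / (∏ i ∈ Finset.range l, γ i)) (q : ℕ) :
    Sys q (fun l x => (P l).eval x) d
      (fun l => β l * (∏ i ∈ Finset.range l, β i) / (∏ i ∈ Finset.range l, γ i)) where
  hd l _ := by
    rw [hd]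
    have h1 := Finset.prod_pos (s := Finset.range l) fun i _ => hP.hβ i
    have h2 := Finset.prod_pos (s := Finset.range l) fun i _ => hP.hγ i
    have h3 := hP.hρ l
    positivity
  hκ l _ := by
    have h1 := Finset.prod_pos (s := Finset.range l) fun i _ => hP.hβ i
    have h2 := Finset.prod_pos (s := Finset.range l) fun i _ => hP.hγ i
    have h3 := hP.hβ l
    positivity
  h0 x := by simp [hP.hP0]
  cont l _ := (P l).continuous
  ev l _ := by
    rcases Nat.eq_zero_or_pos l with h | h
    · subst h
      simp [hP.hP0]
    · have hdl := rec_deg hP l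
      have hnat : (P l).natDegree = l :=
        le_antisymm hdl.1 (Polynomial.le_natDegree_of_ne_zero hdl.2.ne')
      refine (Polynomial.tendsto_atTop_of_leadingCoeff_nonneg (P l) ?_ ?_).eventually_gt_atTop 0
      · exact Polynomial.natDegree_pos_iff_degree_pos.1 (by omega)
      · rw [Polynomial.leadingCoeff, hnat]; exact hdl.2.le
  cd l _ x y := by
    induction l with
    | zero =>
      rw [Ker_zero, hd]
      have hx := congrArg (Polynomial.eval x) hP.hrec0
      have hy := congrArg (Polynomial.eval y) hP.hrec0
      simp [hP.hP0] at hx hy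
      simp [hP.hP0]
      linear_combination hx - hy
    | succ l ih =>
      rw [Ker_succ, mul_add, ← ih (by omega), hd]
      have hx := congrArg (Polynomial.eval x) (hP.hrec l)
      have hy := congrArg (Polynomial.eval y) (hP.hrec l)
      simp only [Polynomial.eval_add, Polynomial.eval_mul, Polynomial.eval_C,
        Polynomial.eval_X] at hx hy
      have h2 := (Finset.prod_pos (s := Finset.range l) fun i _ => hP.hγ i).ne'
      have h3 := (hP.hγ l).ne'
      simp only [Finset.prod_range_succ]
      set b := ∏ i ∈ Finset.range l, β i
      set g := ∏ i ∈ Finset.range l, γ i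
      field_simp
      linear_combination b * β l * (P (l + 1)).eval y * hx - b * β l * (P (l + 1)).eval x * hy

lemma rec_fac {α β γ ρ : ℕ → ℝ} {P : ℕ → Polynomial ℝ} (hP : Recurrence α β γ ρ P) {q : ℕ} {η : ℝ}
    {Λ : ℕ → ℝ} (hΛ : SLZeros P q η Λ) :
    P (q + 1) - Polynomial.C η * P q = Polynomial.C ((P (q + 1)).coeff (q + 1)) *
      ∏ j ∈ Finset.range (q + 1), (Polynomial.X - Polynomial.C (Λ j)) := by
  set c := (P (q + 1)).coeff (q + 1) with hc
  set M : Polynomial ℝ := ∏ j ∈ Finset.range (q + 1), (Polynomial.X - Polynomial.C (Λ j)) with hM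
  have hMm : M.Monic := Polynomial.monic_prod_of_monic _ _ fun j _ => Polynomial.monic_X_sub_C _
  have hMd : M.natDegree = q + 1 := by
    rw [hM, Polynomial.natDegree_prod_of_monic _ _ fun j _ => Polynomial.monic_X_sub_C _]
    simp
  have h1 := rec_deg hP (q + 1)
  have h2 := rec_deg hP q
  rw [← sub_eq_zero]
  set D := P (q + 1) - Polynomial.C η * P q - Polynomial.C c * M with hD
  have hDd : D.natDegree ≤ q := by
    rw [Polynomial.natDegree_le_iff_coeff_eq_zero]
    intro N hN
    simp only [hD, Polynomial.coeff_sub, Polynomial.coeff_C_mul]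
    rw [Polynomial.coeff_eq_zero_of_natDegree_lt (show (P q).natDegree < N by omega)]
    rcases Nat.lt_or_ge (q + 1) N with h | h
    · rw [Polynomial.coeff_eq_zero_of_natDegree_lt (show (P (q + 1)).natDegree < N by omega),
        Polynomial.coeff_eq_zero_of_natDegree_lt (show M.natDegree < N by omega)]
      ring
    · have : N = q + 1 := by omega
      subst this
      have : M.coeff (q + 1) = 1 := by rw [← hMd]; exact hMm.coeff_natDegree
      rw [this, hc]; ring
  have hinj : Set.InjOn Λ (Finset.range (q + 1)) := by
    intro i hi j hj hij
    simp only [Finset.coe_range, Set.mem_Iio] at hi hj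
    exact hΛ.anti.injOn (Set.mem_Iic.2 (by omega)) (Set.mem_Iic.2 (by omega)) hij
  refine Polynomial.eq_zero_of_natDegree_lt_card_of_eval_eq_zero' D ((Finset.range (q + 1)).image Λ) ?_ ?_
  · intro x hx
    obtain ⟨i, hi, rfl⟩ := Finset.mem_image.1 hx
    have hr := hΛ.root i (by simpa [Nat.lt_succ_iff] using hi)
    have hm : M.eval (Λ i) = 0 := by
      rw [hM, Polynomial.eval_prod]
      exact Finset.prod_eq_zero hi (by simp)
    rw [hD, Polynomial.eval_sub, hr, Polynomial.eval_mul, hm]; ring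
  · rw [Finset.card_image_of_injOn hinj, Finset.card_range]; omega

/-- monotonicity of the coefficients of polynomials with removed largest
zeros: let `(A,B)` contain all zeros of `P_q`, `η_B = P_{q+1}(B)/P_q(B)`, let
`λ_{q+1} < ⋯ < λ_1` be the zeros of `P̃_{q+1} = P_{q+1} - η P_q` and let
`a_0,…,a_{q-m}` be the coefficients in
`P̃_{q+1}(λ)/((λ-λ_1)⋯(λ-λ_{m+1})) = Σ_{l=0}^{q-m} d_l a_l P_l(λ)`. Then:
(a) if `m ≥ 1`, or `m = 0` and `η < η_B`, the quotients `a_l / P_l(B)` strictly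
decrease and the last one is positive; (b) if `m = 0` and `η = η_B` they are all equal
and positive; (c) if `m = 0` and `η > η_B` they are positive and strictly increase. -/
theorem stmt_17 (α β γ ρ : ℕ → ℝ) (P : ℕ → Polynomial ℝ)
    (hP : Recurrence α β γ ρ P)
    (d : ℕ → ℝ)
    (hd : ∀ l, d l = ρ l * (∏ i ∈ Finset.range l, β i) / (∏ i ∈ Finset.range l, γ i))
    (q : ℕ) (hq : 1 ≤ q) (m : ℕ) (hm : m ≤ q) (η : ℝ)
    (A B : ℝ) (hAB : ∀ x : ℝ, (P q).eval x = 0 → A < x ∧ x < B)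
    (Λ : ℕ → ℝ) (hΛ : SLZeros P q η Λ)
    (a : ℕ → ℝ)
    (ha : P (q + 1) - Polynomial.C η * P q =
      (∏ j ∈ Finset.range (m + 1), (Polynomial.X - Polynomial.C (Λ j))) *
        (∑ l ∈ Finset.range (q - m + 1), Polynomial.C (d l * a l) * P l)) :
    ((1 ≤ m ∨ (m = 0 ∧ η < (P (q + 1)).eval B / (P q).eval B)) →
      (∀ l, l < q - m →
        a (l + 1) / (P (l + 1)).eval B < a l / (P l).eval B) ∧
      0 < a (q - m) / (P (q - m)).eval B) ∧
    ((m = 0 ∧ η = (P (q + 1)).eval B / (P q).eval B) →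
      (∀ l ≤ q, a l / (P l).eval B = a 0 / (P 0).eval B) ∧
      0 < a 0 / (P 0).eval B) ∧
    ((m = 0 ∧ (P (q + 1)).eval B / (P q).eval B < η) →
      0 < a 0 / (P 0).eval B ∧
      ∀ l, l < q → a l / (P l).eval B < a (l + 1) / (P (l + 1)).eval B) := by
  have S := rec_sys hP hd q
  set κ : ℕ → ℝ := fun l => β l * (∏ i ∈ Finset.range l, β i) / (∏ i ∈ Finset.range l, γ i)
  have hdeg := rec_deg hP
  have hfacP := rec_fac hP hΛ
  have hc := (hdeg (q + 1)).2
  set c := (P (q + 1)).coeff (q + 1)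
  have hfac : ∀ x, (P (q + 1)).eval x - η * (P q).eval x =
      c * ∏ j ∈ Finset.range (q + 1), (x - Λ j) := by
    intro x
    have := congrArg (Polynomial.eval x) hfacP
    simpa [Polynomial.eval_prod] using this
  have hB : ∀ l ≤ q, ∀ x ≥ B, 0 < (P l).eval x := by
    rcases S.dichotomy B with h | ⟨x, hx, h0, _⟩
    · exact h
    · exact absurd (hAB x h0).2 (not_lt.2 hx)
  have hp : ∀ l ≤ q, 0 < (P l).eval (Λ 0) := fun l hl => pos_top S hc hΛ.anti hfac l hl _ le_rfl
  have hb : ∀ l ≤ q, 0 < (P l).eval B := fun l hl => hB l hl B le_rfl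
  -- the quotient polynomial
  have hquot : ∑ l ∈ Finset.range (q - m + 1), Polynomial.C (d l * a l) * P l =
      Polynomial.C c * ∏ j ∈ Finset.range (q - m), (Polynomial.X - Polynomial.C (Λ (m + 1 + j))) := by
    have hne : (∏ j ∈ Finset.range (m + 1), (Polynomial.X - Polynomial.C (Λ j))) ≠ 0 :=
      Finset.prod_ne_zero_iff.2 fun j _ => Polynomial.X_sub_C_ne_zero _
    apply mul_left_cancel₀ hne
    rw [← ha, hfacP, show q + 1 = (m + 1) + (q - m) by omega, Finset.prod_range_add]
    ring
  have hident : ∀ s : ℕ → ℝ, (∀ x, c * ∏ j ∈ Finset.range (q - m), (x - Λ (m + 1 + j)) =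
      ∑ l ∈ Finset.range (q - m + 1), d l * s l * (P l).eval x) → ∀ l ≤ q - m, a l = s l := by
    intro s hs l hl
    have h1 : ∑ l ∈ Finset.range (q - m + 1), Polynomial.C (d l * a l) * P l =
        ∑ l ∈ Finset.range (q - m + 1), Polynomial.C (d l * s l) * P l := by
      rw [hquot]
      apply Polynomial.funext
      intro x
      have := hs x
      simpa [Polynomial.eval_prod, Polynomial.eval_finsetSum] using this
    have h2 := coeffs_unique hdeg _ _ _ h1 l (by omega)
    exact mul_left_cancel₀ (S.hd l (by omega)).ne' h2
  have hr : (P (q + 1)).eval (Λ 0) = η * (P q).eval (Λ 0) := by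
    have := hfac (Λ 0)
    rw [Finset.prod_range_succ'] at this
    simp at this
    linarith
  have hKpos : ∀ l ≤ q, 0 < Ker d (fun l x => (P l).eval x) l B (Λ 0) := fun l hl =>
    Ker_pos S.h0 (fun k hk => S.hd k (by omega)) (fun k hk => (hb k (by omega)).le)
      (fun k hk => (hp k (by omega)).le)
  have hbq := hb q le_rfl
  have hpq := hp q le_rfl
  have hκq := S.hκ q le_rfl
  have hKq := hKpos q le_rfl
  have hcdq : κ q * (P q).eval (Λ 0) * ((P (q + 1)).eval B - η * (P q).eval B) =
      (B - Λ 0) * Ker d (fun l x => (P l).eval x) q B (Λ 0) := by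
    have := S.cd q le_rfl B (Λ 0)
    simp only [hr] at this
    rw [← this]; ring
  have hcoef0 : m = 0 → ∀ l ≤ q, a l = (P l).eval (Λ 0) / (κ q * (P q).eval (Λ 0)) := by
    intro h0 l hl
    subst h0
    refine hident (fun l => (P l).eval (Λ 0) / (κ q * (P q).eval (Λ 0))) (fun x => ?_) l (by omega)
    have h1 := Pst_fac S hfac x
    have h2 : c * ∏ j ∈ Finset.range (q - 0), (x - Λ (0 + 1 + j)) =
        1 / (κ q * (P q).eval (Λ 0)) * Pst (fun l x => (P l).eval x) d (Λ 0) q x := by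
      rw [h1]
      field_simp
      simp [add_comm]
    rw [h2]
    unfold Pst Ker
    rw [Finset.mul_sum]
    exact Finset.sum_congr rfl fun k _ => by ring
  have hstep : ∀ l < q, κ l * ((P (l + 1)).eval B * (P l).eval (Λ 0) -
      (P l).eval B * (P (l + 1)).eval (Λ 0)) =
      (B - Λ 0) * Ker d (fun l x => (P l).eval x) l B (Λ 0) := fun l hl => S.cd l (by omega) B (Λ 0)
  refine ⟨?_, ?_, ?_⟩
  · intro hcase
    have hlt : m = 0 → Λ 0 < B := by
      intro h0
      rcases hcase with h | ⟨_, h⟩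
      · omega
      · rw [lt_div_iff₀ hbq] at h
        have h1 : 0 < (B - Λ 0) * Ker d (fun l x => (P l).eval x) q B (Λ 0) := by
          rw [← hcdq]
          exact mul_pos (mul_pos hκq hpq) (by linarith)
        have := (mul_pos_iff_of_pos_right hKq).1 h1
        linarith
    obtain ⟨t, ht, hteq⟩ := main_cone m q _ d κ Λ η c B S hm hc hΛ.anti hfac hB hlt
    have hcoef := hident
      (fun k => (P k).eval B * ∑ l ∈ Finset.Ico k (q - m + 1), t l) (fun x => by
        rw [hteq x]
        unfold Ker
        simp only [Finset.mul_sum, Finset.sum_mul]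
        rw [Finset.range_eq_Ico, Finset.sum_sigma', Finset.sum_sigma']
        refine Finset.sum_bij' (fun z _ => ⟨z.2, z.1⟩) (fun z _ => ⟨z.2, z.1⟩) ?_ ?_ ?_ ?_ ?_
        · rintro ⟨i, j⟩ h
          simp at h ⊢
          omega
        · rintro ⟨i, j⟩ h
          simp at h ⊢
          omega
        · rintro ⟨i, j⟩ _; rfl
        · rintro ⟨i, j⟩ _; rfl
        · rintro ⟨i, j⟩ _
          simp only
          ring)
    have hq' : ∀ l ≤ q - m, a l / (P l).eval B = ∑ k ∈ Finset.Ico l (q - m + 1), t k := by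
      intro l hl
      have := hb l (by omega)
      rw [hcoef l hl]
      field_simp
    constructor
    · intro l hl
      rw [hq' l hl.le, hq' (l + 1) hl, Finset.sum_eq_sum_Ico_succ_bot (show l < q - m + 1 by omega)]
      have := ht l hl.le
      linarith
    · rw [hq' _ le_rfl]
      simpa using ht _ le_rfl
  · rintro ⟨h0, h⟩
    have hBΛ : B - Λ 0 = 0 := by
      rw [eq_div_iff hbq.ne'] at h
      rw [h, sub_self, mul_zero] at hcdq
      exact (mul_eq_zero.1 hcdq.symm).resolve_right hKq.ne'
    have hBe : Λ 0 = B := by linarith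
    have hval : ∀ l ≤ q, a l / (P l).eval B = 1 / (κ q * (P q).eval B) := by
      intro l hl
      have := hb l hl
      rw [hcoef0 h0 l hl, hBe]
      field_simp
    refine ⟨fun l hl => by rw [hval l hl, hval 0 (by omega)], ?_⟩
    rw [hval 0 (by omega)]
    positivity
  · rintro ⟨h0, h⟩
    have hBΛ : B - Λ 0 < 0 := by
      rw [div_lt_iff₀ hbq] at h
      have h1 : (B - Λ 0) * Ker d (fun l x => (P l).eval x) q B (Λ 0) < 0 := by
        rw [← hcdq]
        exact mul_neg_of_pos_of_neg (mul_pos hκq hpq) (by linarith)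
      by_contra hcon
      exact absurd (mul_nonneg (not_lt.1 hcon) hKq.le) (not_le.2 h1)
    constructor
    · rw [hcoef0 h0 0 (by omega)]
      have := hb 0 (by omega)
      have := hp 0 (by omega)
      positivity
    · intro l hl
      have h1 := hb l (by omega)
      have h2 := hb (l + 1) (by omega)
      have h3 := hstep l hl
      have h4 := mul_neg_of_neg_of_pos hBΛ (hKpos l (by omega))
      rw [← h3] at h4
      have h5 : (P (l + 1)).eval B * (P l).eval (Λ 0) -
          (P l).eval B * (P (l + 1)).eval (Λ 0) < 0 := by
        by_contra hcon
        exact absurd (mul_nonneg (S.hκ l (by omega)).le (not_lt.1 hcon)) (not_le.2 h4)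
      rw [hcoef0 h0 l (by omega), hcoef0 h0 (l + 1) (by omega), div_right_comm,
        div_right_comm ((P (l + 1)).eval (Λ 0))]
      apply div_lt_div_of_pos_right _ (mul_pos hκq hpq)
      rw [div_lt_div_iff₀ h1 h2]
      linarith

end DiscPaper
end

section
/- Let μ be a finite positive Borel measure on [−1,1] with infinite support, and let (U_l)_{l≥0} be real polynomials with deg U_l = l, U_l(1) = 1, and ∫_{−1}^{1} U_l U_k dμ = 0 for l ≠ k; set d_l = (∫_{−1}^{1} U_l^2 dμ)^{−1}. For a real polynomial p, write a_l(p) = ∫_{−1}^{1} p U_l dμ and μ_i(p) = ∫_{−1}^{1} t^i p(t) dμ(t); say p ∈ Π_+ if a_l(p) ≥ 0 for all l. Assume the Krein property: U_j U_k ∈ Π_+ for all j,k. Let q ∈ ℕ, m ∈ {0,…,q}, n = 2q − m + 1, and let t_1 > ⋯ > t_{q+1} be the zeros of U_{q+1}. Define K_n(μ,m) as the set of real polynomials p of degree at most n with p ∈ Π_+, μ_i(p) = 0 for i = 0,…,m−1, and μ_m(p) ≥ 0, and B_n(μ,m) = sup over nonzero p ∈ K_n(μ,m) of sup{λ ∈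 [−1,1] : (−1)^{m−1} p(t) ≥ 0 for all −1 ≤ t ≤ λ}. Then B_n(μ,m) = t_{m+1}; the polynomial p*(t) = U_{q+1}^2(t)/((t−t_1)⋯(t−t_{m+1})) belongs to K_n(μ,m)\{0}, satisfies (−1)^{m−1}p*(t) ≥ 0 for −1 ≤ t ≤ t_{m+1} and a_m(p*) = 0, and every nonzero p ∈ K_n(μ,m) with (−1)^{m−1}p(t) ≥ 0 for all −1 ≤ t ≤ t_{m+1} is a positive constant multiple of p*. -/
namespace DiscPaper

open MeasureTheory Polynomial

/-- The Fourier coefficient `a_l(p) = ∫ p U_l dμ`. -/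
noncomputable def aCoef (μ : Measure ℝ) (U : ℕ → Polynomial ℝ) (l : ℕ)
    (p : Polynomial ℝ) : ℝ :=
  ∫ x, p.eval x * (U l).eval x ∂μ

/-- `p ∈ Π₊({U_l})`: all Fourier coefficients of `p` in the system `U` are
nonnegative. -/
def PiPlus (μ : Measure ℝ) (U : ℕ → Polynomial ℝ) (p : Polynomial ℝ) : Prop :=
  ∀ l, 0 ≤ aCoef μ U l p

/-- The `i`-th moment `μ_i(p) = ∫ t^i p(t) dμ(t)`. -/
noncomputable def moment (μ : Measure ℝ) (i : ℕ) (p : Polynomial ℝ) : ℝ :=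
  ∫ x, x ^ i * p.eval x ∂μ

/-- The class `K_n(μ,m)` of polynomials of degree at most `n` with nonnegative Fourier
coefficients, vanishing first `m` moments and nonnegative `m`-th moment. -/
def Kset (μ : Measure ℝ) (U : ℕ → Polynomial ℝ) (n m : ℕ) : Set (Polynomial ℝ) :=
  {p | p.natDegree ≤ n ∧ PiPlus μ U p ∧ (∀ i < m, moment μ i p = 0) ∧
    0 ≤ moment μ m p}

/-- `B_n(μ,m)`: the supremum over nonzero `p ∈ K_n(μ,m)` of the `λ ∈ [-1,1]` up to
which `(-1)^{m-1} p ≥ 0` on `[-1,λ]`. -/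
noncomputable def Bsup (μ : Measure ℝ) (U : ℕ → Polynomial ℝ) (n m : ℕ) : ℝ :=
  sSup {x : ℝ | ∃ p ∈ Kset μ U n m, p ≠ 0 ∧ -1 ≤ x ∧ x ≤ 1 ∧
    ∀ s : ℝ, -1 ≤ s → s ≤ x → 0 ≤ (-1 : ℝ) ^ (m + 1) * p.eval s}


/-- Cone of nonnegative combinations of `P 0, …, P N`. -/
inductive InCone (P : ℕ → ℝ[X]) (N : ℕ) : ℝ[X] → Prop
  | zero : InCone P N 0
  | basis (l : ℕ) (hl : l ≤ N) : InCone P N (P l)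
  | add (f g : ℝ[X]) (hf : InCone P N f) (hg : InCone P N g) : InCone P N (f + g)
  | smul (c : ℝ) (hc : 0 ≤ c) (f : ℝ[X]) (hf : InCone P N f) : InCone P N (C c * f)

lemma InCone.sum {P : ℕ → ℝ[X]} {N : ℕ} (s : Finset ℕ) (f : ℕ → ℝ[X])
    (h : ∀ i ∈ s, InCone P N (f i)) : InCone P N (∑ i ∈ s, f i) := by
  classical
  induction s using Finset.induction_on with
  | empty => simpa using InCone.zero
  | insert a s ha ih =>
    rw [Finset.sum_insert ha]
    exact InCone.add _ _ (h a (by simp)) (ih fun i hi => h i (by simp [hi]))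

lemma InCone.trans {P Q : ℕ → ℝ[X]} {N M : ℕ} (h : ∀ i ≤ M, InCone P N (Q i))
    {f : ℝ[X]} (hf : InCone Q M f) : InCone P N f := by
  induction hf with
  | zero => exact InCone.zero
  | basis l hl => exact h l hl
  | add f g _ _ h1 h2 => exact InCone.add _ _ h1 h2
  | smul c hc f _ h1 => exact InCone.smul c hc _ h1

lemma expand {P : ℕ → ℝ[X]} {N : ℕ} (hdeg : ∀ l ≤ N, (P l).natDegree = l)
    (hlc : ∀ l ≤ N, 0 < (P l).leadingCoeff) (i : ℕ) (hi : i ≤ N) (g : ℝ[X])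
    (hg : g.natDegree ≤ i) : ∃ c : ℕ → ℝ, g = ∑ l ∈ Finset.range (i + 1), C (c l) * P l := by
  induction i generalizing g with
  | zero =>
    have h0 := hdeg 0 hi
    have hl := hlc 0 hi
    rw [leadingCoeff, h0] at hl
    refine ⟨fun _ => g.coeff 0 / (P 0).coeff 0, ?_⟩
    rw [zero_add, Finset.sum_range_one]
    conv_lhs => rw [eq_C_of_natDegree_le_zero hg]
    conv_rhs => rw [eq_C_of_natDegree_le_zero h0.le]
    rw [← C_mul, coeff_C_zero, div_mul_cancel₀ _ hl.ne']
  | succ i ih =>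
    have h0 := hdeg (i+1) hi
    have hl := hlc (i+1) hi
    rw [leadingCoeff, h0] at hl
    set a := g.coeff (i+1) / (P (i+1)).coeff (i+1) with ha
    obtain ⟨c, hc⟩ := ih (by omega) (g - C a * P (i+1)) (by
      rw [natDegree_le_iff_coeff_eq_zero]
      intro k hk
      rw [coeff_sub, coeff_C_mul]
      rcases eq_or_ne k (i+1) with rfl | hne
      · rw [ha]; field_simp; simp
      · rw [coeff_eq_zero_of_natDegree_lt (by omega), coeff_eq_zero_of_natDegree_lt (by omega)]
        simp)
    refine ⟨fun l => if l = i+1 then a else c l, ?_⟩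
    rw [Finset.sum_range_succ]
    simp only [if_true]
    rw [Finset.sum_congr rfl (g := fun l => C (c l) * P l), ← hc]
    · ring
    · intro l hl
      have : l ≠ i + 1 := by have := Finset.mem_range.1 hl; omega
      simp [this]

lemma orth_low {P : ℕ → ℝ[X]} {N : ℕ} (hdeg : ∀ l ≤ N, (P l).natDegree = l)
    (hlc : ∀ l ≤ N, 0 < (P l).leadingCoeff) (L : ℝ[X] →ₗ[ℝ] ℝ)
    (ho : ∀ l ≤ N, ∀ k ≤ N, l ≠ k → L (P l * P k) = 0) (l : ℕ) (hl : l ≤ N) (g : ℝ[X])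
    (hg : g.natDegree < l) : L (P l * g) = 0 := by
  obtain ⟨c, hc⟩ := expand hdeg hlc (l-1) (by omega) g (by omega)
  rw [hc, Finset.mul_sum, map_sum]
  apply Finset.sum_eq_zero
  intro i hi
  have := Finset.mem_range.1 hi
  rw [mul_left_comm, ← smul_eq_C_mul, map_smul, ho l hl i (by omega) (by omega), smul_zero]

lemma pos_of_no_root (P : ℝ[X]) (hlc : 0 < P.leadingCoeff) (a : ℝ)
    (h : ∀ r, a ≤ r → P.eval r ≠ 0) : 0 < P.eval a := by
  by_contra hn
  have hn : P.eval a < 0 := lt_of_le_of_ne (not_lt.1 hn) (h a le_rfl)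
  have hd : 0 < P.degree := by
    by_contra hd
    have := eq_C_of_degree_le_zero (not_lt.1 hd)
    rw [this] at hlc hn
    simp at hlc hn
    linarith
  have ht := P.tendsto_atTop_of_leadingCoeff_nonneg hd hlc.le
  obtain ⟨b, hb0, hb1⟩ := ((ht.eventually_ge_atTop 1).and (Filter.eventually_ge_atTop a)).exists
  obtain ⟨r, hr, hr0⟩ := intermediate_value_Icc hb1 (P.continuous.continuousOn)
    (show (0:ℝ) ∈ Set.Icc _ _ from ⟨hn.le, by linarith⟩)
  exact h r hr.1 hr0

/-- No roots at `r` if the functional is definite on `(r - X) R²`. -/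
lemma no_root (P : ℝ[X]) (L : ℝ[X] →ₗ[ℝ] ℝ) (ho : ∀ g : ℝ[X], g.natDegree < P.natDegree → L (P * g) = 0)
    (hP : P ≠ 0) (r : ℝ) (hpos : ∀ R : ℝ[X], R ≠ 0 → R.natDegree < P.natDegree → L ((X - C r) * R ^ 2) ≠ 0) :
    P.eval r ≠ 0 := by
  intro h
  obtain ⟨R, hR⟩ := dvd_iff_isRoot.2 h
  have hR0 : R ≠ 0 := by rintro rfl; simp at hR; exact hP hR
  have hd : R.natDegree < P.natDegree := by
    rw [hR, natDegree_mul (X_sub_C_ne_zero r) hR0, natDegree_X_sub_C]; omega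
  apply hpos R hR0 hd
  rw [← ho R hd, hR]; ring_nf

noncomputable def dL (t w : ℕ → ℝ) (N : ℕ) : ℝ[X] →ₗ[ℝ] ℝ :=
  ∑ j ∈ Finset.range (N+1), w j • (leval (t j))

lemma dL_apply (t w : ℕ → ℝ) (N : ℕ) (f : ℝ[X]) :
    dL t w N f = ∑ j ∈ Finset.range (N+1), w j * f.eval (t j) := by
  simp [dL, leval]

lemma exists_node (t : ℕ → ℝ) (s : Finset ℕ) (hinj : Set.InjOn t s) (R : ℝ[X]) (hR : R ≠ 0)
    (hd : R.natDegree < s.card) : ∃ j ∈ s, R.eval (t j) ≠ 0 := by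
  by_contra! h
  exact hR (eq_zero_of_natDegree_lt_card_of_eval_eq_zero' R (s.image t)
    (by simpa using h) (by rwa [Finset.card_image_of_injOn hinj]))

structure Sys_s18 (t w : ℕ → ℝ) (N : ℕ) (P : ℕ → ℝ[X]) : Prop where
  anti : StrictAntiOn t (Set.Iic N)
  wpos : ∀ j ≤ N, 0 < w j
  deg : ∀ l ≤ N, (P l).natDegree = l
  lc : ∀ l ≤ N, 0 < (P l).leadingCoeff
  orth : ∀ l ≤ N, ∀ k ≤ N, l ≠ k → dL t w N (P l * P k) = 0

lemma Sys_s18.hpos {t w : ℕ → ℝ} {N : ℕ} {P : ℕ → ℝ[X]} (S : Sys_s18 t w N P) (l : ℕ) (hl : l ≤ N) :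
    0 < dL t w N (P l * P l) := by
  rw [dL_apply]
  have hne : P l ≠ 0 := leadingCoeff_ne_zero.1 (S.lc l hl).ne'
  obtain ⟨j, hj, hj0⟩ := exists_node t (Finset.range (N+1))
    (S.anti.injOn.mono (fun x hx => by simp at hx ⊢; omega)) (P l) hne (by
      rw [S.deg l hl]; simp; omega)
  refine Finset.sum_pos' (fun i hi => ?_) ⟨j, hj, ?_⟩
  · have := S.wpos i (by simp at hi; omega)
    rw [eval_mul]; exact mul_nonneg this.le (mul_self_nonneg _)
  · have := S.wpos j (by simp at hj; omega)
    rw [eval_mul]; exact mul_pos this (mul_self_pos.2 hj0)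

lemma Sys_s18.evpos {t w : ℕ → ℝ} {N : ℕ} {P : ℕ → ℝ[X]} (S : Sys_s18 t w N P) (l : ℕ) (hl : l ≤ N) :
    0 < (P l).eval (t 0) := by
  have hne : P l ≠ 0 := leadingCoeff_ne_zero.1 (S.lc l hl).ne'
  apply pos_of_no_root _ (S.lc l hl)
  intro r hr
  apply no_root _ (dL t w N) _ hne
  · intro R hR hd
    rw [S.deg l hl] at hd
    obtain ⟨j, hj, hj0⟩ := exists_node t (Finset.Ioc 0 N)
      (S.anti.injOn.mono (fun x hx => by simp at hx ⊢; omega)) R hR (by simp; omega)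
    have hlt : ∀ i ≤ N, 0 < i → t i < t 0 := fun i hi h0 =>
      S.anti (by simp) (by simpa using hi) h0
    simp only [Finset.mem_Ioc] at hj
    apply ne_of_lt
    rw [dL_apply, ← neg_pos, ← Finset.sum_neg_distrib]
    refine Finset.sum_pos' (fun i hi => ?_) ⟨j, by simp; omega, ?_⟩
    · have h1 := S.wpos i (by simp at hi; omega)
      have h2 : t i ≤ t 0 := by
        rcases Nat.eq_zero_or_pos i with rfl | h
        · exact le_rfl
        · exact (hlt i (by simp at hi; omega) h).le
      have : -(w i * eval (t i) ((X - C r) * R ^ 2)) = w i * ((r - t i) * (eval (t i) R)^2) := by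
        simp; ring
      rw [this]
      exact mul_nonneg h1.le (mul_nonneg (by linarith) (sq_nonneg _))
    · have h1 := S.wpos j (by omega)
      have h2 := hlt j hj.2 hj.1
      have : -(w j * eval (t j) ((X - C r) * R ^ 2)) = w j * ((r - t j) * (eval (t j) R)^2) := by
        simp; ring
      rw [this]
      exact mul_pos h1 (mul_pos (by linarith) (by positivity))
  · intro g hg
    rw [S.deg l hl] at hg
    exact orth_low S.deg S.lc _ S.orth l hl g hg

lemma Sys_s18.coef {t w : ℕ → ℝ} {N : ℕ} {P : ℕ → ℝ[X]} (S : Sys_s18 t w N P) (i l : ℕ) (hi : i ≤ N)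
    (hl : l ≤ i) (c : ℕ → ℝ) :
    dL t w N ((∑ k ∈ Finset.range (i+1), C (c k) * P k) * P l) = c l * dL t w N (P l * P l) := by
  rw [Finset.sum_mul, map_sum, Finset.sum_eq_single l]
  · rw [mul_assoc, ← smul_eq_C_mul, map_smul, smul_eq_mul]
  · intro k hk hkl
    simp at hk
    rw [mul_assoc, ← smul_eq_C_mul, map_smul, S.orth k (by omega) l (by omega) hkl, smul_zero]
  · intro h; simp at h; omega

/-- kernel polynomials -/
noncomputable def ker (t w : ℕ → ℝ) (N : ℕ) (P : ℕ → ℝ[X]) (i : ℕ) : ℝ[X] :=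
  ∑ l ∈ Finset.range (i+1), C ((P l).eval (t 0) / dL t w N (P l * P l)) * P l

lemma Sys_s18.repro {t w : ℕ → ℝ} {N : ℕ} {P : ℕ → ℝ[X]} (S : Sys_s18 t w N P) (i : ℕ) (hi : i ≤ N)
    (g : ℝ[X]) (hg : g.natDegree ≤ i) : dL t w N (ker t w N P i * g) = g.eval (t 0) := by
  obtain ⟨c, hc⟩ := expand S.deg S.lc i hi g hg
  rw [hc, Finset.mul_sum, map_sum, eval_finsetSum]
  apply Finset.sum_congr rfl
  intro l hl
  simp at hl
  rw [mul_left_comm, ← smul_eq_C_mul, map_smul, ker, S.coef i l hi (by omega),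
    div_mul_cancel₀ _ (S.hpos l (by omega)).ne']
  simp

lemma Sys_s18.ker_cone {t w : ℕ → ℝ} {N : ℕ} {P : ℕ → ℝ[X]} (S : Sys_s18 t w N P) (i : ℕ) (hi : i ≤ N) :
    InCone P N (ker t w N P i) := by
  apply InCone.sum
  intro l hl
  simp at hl
  exact InCone.smul _ (div_nonneg (S.evpos l (by omega)).le (S.hpos l (by omega)).le) _
    (InCone.basis l (by omega))

lemma Sys_s18.ker_deg {t w : ℕ → ℝ} {N : ℕ} {P : ℕ → ℝ[X]} (S : Sys_s18 t w N P) (i : ℕ) (hi : i ≤ N) :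
    (ker t w N P i).natDegree = i ∧ 0 < (ker t w N P i).leadingCoeff := by
  have hle : (ker t w N P i).natDegree ≤ i := by
    apply natDegree_sum_le_of_forall_le
    intro l hl
    simp at hl
    refine (natDegree_C_mul_le _ _).trans ?_
    rw [S.deg l (by omega)]; omega
  have hco : 0 < (ker t w N P i).coeff i := by
    rw [ker, finsetSum_coeff, Finset.sum_range_succ, Finset.sum_eq_zero, zero_add, coeff_C_mul]
    · have := S.lc i hi
      rw [leadingCoeff, S.deg i hi] at this
      exact mul_pos (div_pos (S.evpos i hi) (S.hpos i hi)) this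
    · intro l hl
      simp at hl
      rw [coeff_C_mul, coeff_eq_zero_of_natDegree_lt (by rw [S.deg l (by omega)]; omega), mul_zero]
  have : (ker t w N P i).natDegree = i := le_antisymm hle (le_natDegree_of_ne_zero hco.ne')
  exact ⟨this, by rwa [leadingCoeff, this]⟩

lemma Sys_s18.next {t w : ℕ → ℝ} {N : ℕ} {P : ℕ → ℝ[X]} (S : Sys_s18 t w (N+1) P) :
    Sys_s18 (fun j => t (j+1)) (fun j => (t 0 - t (j+1)) * w (j+1)) N (ker t w (N+1) P) where
  anti := by
    intro a ha b hb hab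
    simp at ha hb
    exact S.anti (by simp; omega) (by simp; omega) (by omega)
  wpos := by
    intro j hj
    exact mul_pos (sub_pos.2 (S.anti (by simp) (by simp; omega) (by omega))) (S.wpos _ (by omega))
  deg := fun l hl => (S.ker_deg l (by omega)).1
  lc := fun l hl => (S.ker_deg l (by omega)).2
  orth := by
    have key : ∀ l ≤ N, ∀ k < l, dL (fun j => t (j+1)) (fun j => (t 0 - t (j+1)) * w (j+1)) N
        (ker t w (N+1) P l * ker t w (N+1) P k) = 0 := by
      intro l hl k hk
      have h1 := S.repro l (by omega) ((C (t 0) - X) * ker t w (N+1) P k) (by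
        refine natDegree_mul_le.trans ?_
        rw [(S.ker_deg k (by omega)).1]
        have : (C (t 0) - X : ℝ[X]).natDegree ≤ 1 := by
          rw [natDegree_sub, natDegree_X_sub_C]
        omega)
      rw [eval_mul] at h1
      simp only [eval_sub, eval_C, eval_X, sub_self, zero_mul] at h1
      rw [dL_apply, Finset.sum_range_succ'] at h1
      simp only [eval_mul, eval_sub, eval_C, eval_X, sub_self, zero_mul, mul_zero, add_zero] at h1
      rw [dL_apply, ← h1]
      apply Finset.sum_congr rfl
      intro j _
      rw [eval_mul]; ring
    intro l hl k hk hlk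
    rcases lt_or_gt_of_ne hlk with h | h
    · rw [mul_comm]; exact key k hk l h
    · exact key l hl k h

lemma main_cone_s18 (m M : ℕ) : ∀ (t w : ℕ → ℝ) (P : ℕ → ℝ[X]), Sys_s18 t w (m + M) P →
    InCone P (m + M) (∏ j ∈ Finset.range M, (X - C (t (m + 1 + j)))) := by
  induction m with
  | zero =>
    intro t w P S
    set f : ℝ[X] := ∏ j ∈ Finset.range M, (X - C (t (0 + 1 + j))) with hf
    have hfd : f.natDegree ≤ 0 + M := by
      rw [hf, natDegree_finsetProd_X_sub_C_eq_card]; simp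
    obtain ⟨c, hc⟩ := expand S.deg S.lc (0 + M) le_rfl f hfd
    rw [hc]
    apply InCone.sum
    intro l hl
    simp at hl
    refine InCone.smul _ ?_ _ (InCone.basis l (by omega))
    have h1 := S.coef (0+M) l le_rfl (by omega) c
    rw [← hc, dL_apply, Finset.sum_range_succ', Finset.sum_eq_zero, zero_add] at h1
    · have h2 := S.hpos l (by omega)
      have h3 : 0 ≤ c l * dL t w (0+M) (P l * P l) := by
        rw [← h1, eval_mul]
        refine mul_nonneg (S.wpos 0 (by omega)).le (mul_nonneg ?_ (S.evpos l (by omega)).le)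
        rw [hf, eval_prod]
        apply Finset.prod_nonneg
        intro j hj
        simp at hj
        simp
        exact (S.anti (by simp) (by simp; omega) (by omega)).le
      exact nonneg_of_mul_nonneg_left h3 h2
    · intro j hj
      simp at hj
      have : f.eval (t (j+1)) = 0 := by
        rw [hf, eval_prod]
        apply Finset.prod_eq_zero (i := j) (by simp; omega)
        simp [add_comm]
      rw [eval_mul, this]; simp
  | succ m ih =>
    intro t w P S
    have e : m + 1 + M = (m + M) + 1 := by ring
    rw [e] at S ⊢
    have := ih _ _ _ S.next
    have e2 : ∀ j, m + 1 + 1 + j = m + 1 + j + 1 := fun j => by omega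
    simp only [e2]
    exact InCone.trans (fun i hi => S.ker_cone i (by omega)) this


lemma poly_integrable (μ : Measure ℝ) [IsFiniteMeasure μ]
    (hcarrier : μ (Set.Icc (-1 : ℝ) 1)ᶜ = 0) (f : ℝ[X]) : Integrable (fun x => f.eval x) μ := by
  have h : μ.restrict (Set.Icc (-1 : ℝ) 1) = μ := Measure.restrict_eq_self_of_ae_mem
    (by rw [ae_iff]; exact hcarrier)
  rw [← h]
  exact (f.continuous.continuousOn).integrableOn_Icc

noncomputable def mL (μ : Measure ℝ) [IsFiniteMeasure μ]
    (hcarrier : μ (Set.Icc (-1 : ℝ) 1)ᶜ = 0) : ℝ[X] →ₗ[ℝ] ℝ where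
  toFun f := ∫ x, f.eval x ∂μ
  map_add' f g := by
    simp only [eval_add]
    exact integral_add (poly_integrable μ hcarrier f) (poly_integrable μ hcarrier g)
  map_smul' c f := by
    simp only [eval_smul, smul_eq_mul, RingHom.id_apply]
    exact integral_const_mul _ _

lemma mL_apply (μ : Measure ℝ) [IsFiniteMeasure μ]
    (hcarrier : μ (Set.Icc (-1 : ℝ) 1)ᶜ = 0) (f : ℝ[X]) :
    mL μ hcarrier f = ∫ x, f.eval x ∂μ := rfl

lemma mL_pos (μ : Measure ℝ) [IsFiniteMeasure μ]
    (hcarrier : μ (Set.Icc (-1 : ℝ) 1)ᶜ = 0)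
    (hinf : ∀ s : Set ℝ, s.Finite → μ sᶜ ≠ 0) (f : ℝ[X]) (hf : f ≠ 0)
    (h0 : ∀ x, -1 ≤ x → x ≤ 1 → 0 ≤ f.eval x) : 0 < mL μ hcarrier f := by
  have hae : ∀ᵐ x ∂μ, x ∈ Set.Icc (-1:ℝ) 1 := by rw [ae_iff]; exact hcarrier
  have h1 : 0 ≤ᵐ[μ] (fun x => f.eval x) := by
    filter_upwards [hae] with x hx using h0 x hx.1 hx.2
  rw [mL_apply]
  refine lt_of_le_of_ne (integral_nonneg_of_ae h1) (fun h => ?_)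
  have h2 := (integral_eq_zero_iff_of_nonneg_ae h1 (poly_integrable μ hcarrier f)).1 h.symm
  refine hinf {x | f.eval x = 0} ?_ ?_
  · refine (f.roots.toFinset.finite_toSet).subset (fun x hx => ?_)
    simp only [Set.mem_ofPred_eq] at hx
    simp [hf, hx]
  · exact h2

lemma quad (μ : Measure ℝ) [IsFiniteMeasure μ]
    (hcarrier : μ (Set.Icc (-1 : ℝ) 1)ᶜ = 0)
    (hinf : ∀ s : Set ℝ, s.Finite → μ sᶜ ≠ 0) (q : ℕ) (V : ℝ[X]) (hV : V.natDegree = q + 1)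
    (ho : ∀ g : ℝ[X], g.natDegree < q + 1 → mL μ hcarrier (V * g) = 0)
    (t : ℕ → ℝ) (ht : StrictAntiOn t (Set.Iic q))
    (htroot : ∀ j ≤ q, V.eval (t j) = 0) :
    ∃ w : ℕ → ℝ, (∀ j ≤ q, 0 < w j) ∧
      ∀ f : ℝ[X], f.natDegree ≤ 2 * q + 1 → mL μ hcarrier f = dL t w q f := by
  classical
  have hinj : Set.InjOn t (Finset.range (q+1)) :=
    ht.injOn.mono (fun x hx => by simp at hx ⊢; omega)
  have hV0 : V ≠ 0 := by rintro rfl; simp at hV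
  let w : ℕ → ℝ := fun j => mL μ hcarrier (Lagrange.basis (Finset.range (q+1)) t j)
  have hq : ∀ f : ℝ[X], f.natDegree ≤ 2 * q + 1 → mL μ hcarrier f = dL t w q f := by
    intro f hf
    have hdm := EuclideanDomain.div_add_mod f V
    have hB : (f % V).degree < (q + 1 : ℕ) := by
      have := EuclideanDomain.mod_lt f hV0
      refine lt_of_lt_of_eq this ?_
      rw [degree_eq_natDegree hV0, hV]
    have hA : (f / V).natDegree < q + 1 := by
      by_cases hA0 : f / V = 0
      · rw [hA0]; simp
      have e1 : V * (f / V) = f - f % V := by rw [eq_sub_iff_add_eq]; exact hdm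
      have e2 := congrArg natDegree e1
      rw [natDegree_mul hV0 hA0, hV] at e2
      have e3 : (f % V).natDegree ≤ q := by
        by_cases hB0 : f % V = 0
        · rw [hB0]; simp
        · rw [degree_eq_natDegree hB0, Nat.cast_lt] at hB
          omega
      have e4 := natDegree_sub_le f (f % V)
      have e5 : max f.natDegree (f % V).natDegree ≤ 2 * q + 1 := max_le hf (by omega)
      omega
    have hBe : ∀ j ≤ q, (f % V).eval (t j) = f.eval (t j) := by
      intro j hj
      conv_rhs => rw [← hdm]
      simp [htroot j hj]
    have hinterp := Lagrange.eq_interpolate (s := Finset.range (q+1)) (f := f % V) hinj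
      (by simpa using hB)
    have h1 : mL μ hcarrier f = mL μ hcarrier (f % V) := by
      conv_lhs => rw [← hdm]
      rw [map_add, ho _ hA, zero_add]
    rw [h1, hinterp, Lagrange.interpolate_apply, map_sum, dL_apply]
    apply Finset.sum_congr rfl
    intro j hj
    simp at hj
    rw [← smul_eq_C_mul, map_smul, hBe j (by omega), smul_eq_mul, mul_comm]
  refine ⟨w, ?_, hq⟩
  intro j hj
  have hjm : j ∈ Finset.range (q+1) := by simp; omega
  set b := Lagrange.basis (Finset.range (q+1)) t j with hb
  have hbd : b.natDegree = q := by
    rw [hb, natDegree_eq_of_degree_eq_some (Lagrange.degree_basis hinj hjm)]; simp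
  have hb0 : b ≠ 0 := Lagrange.basis_ne_zero hinj hjm
  have h1 := mL_pos μ hcarrier hinf (b^2) (pow_ne_zero 2 hb0) (fun x _ _ => by
    rw [eval_pow]; exact sq_nonneg _)
  rw [hq (b^2) (by rw [natDegree_pow, hbd]; omega), dL_apply, Finset.sum_eq_single j] at h1
  · rw [eval_pow, hb, Lagrange.eval_basis_self hinj hjm] at h1
    simpa using h1
  · intro i hi hij
    rw [eval_pow, hb, Lagrange.eval_basis_of_ne hij.symm hi]; simp
  · intro h; exact absurd hjm h

/-- A sign-constant polynomial vanishing at an interior point has a double zero. -/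
lemma double_root (p : ℝ[X]) (e a b r : ℝ) (he : e ≠ 0) (h : ∀ s, a ≤ s → s ≤ b → 0 ≤ e * p.eval s)
    (har : a < r) (hrb : r < b) (hr : p.eval r = 0) : (X - C r) ^ 2 ∣ p := by
  have hmin : IsLocalMin (fun s => (C e * p).eval s) r := by
    filter_upwards [Ioo_mem_nhds har hrb] with s hs
    simpa [hr] using h s hs.1.le hs.2.le
  have hd := hmin.deriv_eq_zero
  rw [Polynomial.deriv] at hd
  have hd : p.derivative.eval r = 0 := by simpa [he] using hd
  obtain ⟨R, hR⟩ := dvd_iff_isRoot.2 hr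
  rw [hR] at hd
  have : R.eval r = 0 := by simpa using hd
  obtain ⟨T, hT⟩ := dvd_iff_isRoot.2 this
  exact ⟨T, by rw [hR, hT]; ring⟩

lemma prod_dvd (t : ℕ → ℝ) (s : Finset ℕ) (hinj : Set.InjOn t s) (k : ℕ) (p : ℝ[X])
    (h : ∀ j ∈ s, (X - C (t j)) ^ k ∣ p) : (∏ j ∈ s, (X - C (t j))) ^ k ∣ p := by
  rw [← Finset.prod_pow]
  apply Finset.prod_dvd_of_coprime
  · intro i hi j hj hij
    apply IsCoprime.pow
    apply isCoprime_X_sub_C_of_isUnit_sub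
    exact (sub_ne_zero.2 (fun h => hij (hinj hi hj h))).isUnit
  · exact h

lemma moment_pairing (μ : Measure ℝ) [IsFiniteMeasure μ]
    (hcarrier : μ (Set.Icc (-1 : ℝ) 1)ᶜ = 0) (p : ℝ[X]) (m : ℕ)
    (h : ∀ i < m, moment μ i p = 0) (g : ℝ[X]) (hg : g.natDegree ≤ m) :
    mL μ hcarrier (p * g) = g.coeff m * moment μ m p := by
  have hmom : ∀ i, mL μ hcarrier (p * X ^ i) = moment μ i p := by
    intro i
    rw [mL_apply, moment]; simp [mul_comm]
  rw [g.as_sum_range_C_mul_X_pow' (Nat.lt_succ_of_le hg), Finset.mul_sum, map_sum,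
    Finset.sum_range_succ, Finset.sum_eq_zero]
  · rw [mul_left_comm, ← smul_eq_C_mul, map_smul, hmom]
    simp [finsetSum_coeff, coeff_X_pow, Finset.sum_range_succ]
  · intro i hi
    simp at hi
    rw [mul_left_comm, ← smul_eq_C_mul, map_smul, hmom, h i hi, smul_zero]

/-- Yudin-type extremal problem, case `n = 2q - m + 1`: under the Krein
property, `B_n(μ,m) = t_{m+1}`, and `p* = U_{q+1}²/((t-t_1)⋯(t-t_{m+1}))` is, up to a
positive constant, the unique extremal polynomial; moreover `a_m(p*) = 0`.
Here `t 0 > t 1 > ⋯ > t q` are the zeros `t_1 > ⋯ > t_{q+1}` of `U_{q+1}`, so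
`t_{m+1} = t m`, and `(-1)^{m+1} = (-1)^{m-1}`. -/
theorem stmt_18
    (μ : Measure ℝ) [IsFiniteMeasure μ]
    (hcarrier : μ (Set.Icc (-1 : ℝ) 1)ᶜ = 0)
    (hinf : ∀ s : Set ℝ, s.Finite → μ sᶜ ≠ 0)
    (U : ℕ → Polynomial ℝ)
    (hdeg : ∀ l, (U l).natDegree = l)
    (hnorm : ∀ l, (U l).eval 1 = 1)
    (horth : ∀ l k, l ≠ k → ∫ x, (U l).eval x * (U k).eval x ∂μ = 0)
    (hKrein : ∀ j k, PiPlus μ U (U j * U k))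
    (q m : ℕ) (hm : m ≤ q) (n : ℕ) (hn : n = 2 * q - m + 1)
    (t : ℕ → ℝ) (ht : StrictAntiOn t (Set.Iic q))
    (htroot : ∀ j ≤ q, (U (q + 1)).eval (t j) = 0) :
    Bsup μ U n m = t m ∧
    ∃ pstar : Polynomial ℝ,
      pstar * (∏ j ∈ Finset.range (m + 1), (X - C (t j))) = (U (q + 1)) ^ 2 ∧
      pstar ∈ Kset μ U n m ∧ pstar ≠ 0 ∧
      (∀ s : ℝ, -1 ≤ s → s ≤ t m → 0 ≤ (-1 : ℝ) ^ (m + 1) * pstar.eval s) ∧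
      aCoef μ U m pstar = 0 ∧
      ∀ p ∈ Kset μ U n m, p ≠ 0 →
        (∀ s : ℝ, -1 ≤ s → s ≤ t m → 0 ≤ (-1 : ℝ) ^ (m + 1) * p.eval s) →
        ∃ c : ℝ, 0 < c ∧ p = C c * pstar := by
  have hn : n = 2 * q + 1 - m := by omega
  set L := mL μ hcarrier with hL
  -- leading coefficients, orthogonality
  have hU0 : ∀ l, U l ≠ 0 := fun l h => by have := hnorm l; simp [h] at this
  have horthL : ∀ l k, l ≠ k → L (U l * U k) = 0 := by
    intro l k h
    rw [hL, mL_apply]; simpa using horth l k h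
  have hlc : ∀ l, 0 < (U l).leadingCoeff := by
    intro l
    induction l using Nat.strong_induction_on with
    | _ l ih =>
    by_contra hneg
    have hneg : (U l).leadingCoeff < 0 :=
      lt_of_le_of_ne (not_lt.1 hneg) (leadingCoeff_ne_zero.2 (hU0 l))
    have ho : ∀ g : ℝ[X], g.natDegree < l → L (U l * g) = 0 := by
      intro g hg
      obtain ⟨c, hc⟩ := expand (N := l - 1) (fun k _ => hdeg k) (fun k hk => ih k (by omega))
        (l-1) le_rfl g (by omega)
      rw [hc, Finset.mul_sum, map_sum]
      apply Finset.sum_eq_zero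
      intro i hi
      have := Finset.mem_range.1 hi
      rw [mul_left_comm, ← smul_eq_C_mul, map_smul, horthL l i (by omega), smul_zero]
    have h1 := pos_of_no_root (-(U l)) (by rw [leadingCoeff_neg]; linarith) 1 (by
      intro r hr
      rw [eval_neg, neg_ne_zero]
      apply no_root _ L (by rw [hdeg l]; exact ho) (hU0 l)
      intro R hR _
      have := mL_pos μ hcarrier hinf ((C r - X) * R ^ 2)
        (mul_ne_zero (by rw [← neg_sub, neg_ne_zero]; exact X_sub_C_ne_zero r) (pow_ne_zero 2 hR))
        (fun x _ hx => by
          simp only [eval_mul, eval_sub, eval_C, eval_X, eval_pow]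
          exact mul_nonneg (by linarith) (sq_nonneg _))
      have e : (X - C r) * R ^ 2 = -((C r - X) * R ^ 2) := by ring
      rw [e, map_neg, neg_ne_zero]
      exact this.ne')
    rw [eval_neg, hnorm l] at h1
    linarith
  have hlow : ∀ l, ∀ g : ℝ[X], g.natDegree < l → L (U l * g) = 0 := fun l g hg =>
    orth_low (N := l) (fun k _ => hdeg k) (fun k _ => hlc k) L
      (fun i _ k _ hik => horthL i k hik) l le_rfl g hg
  -- location of the nodes
  have htlt : ∀ j ≤ q, t j < 1 := by
    intro j hj
    by_contra h
    refine no_root (U (q+1)) L (by rw [hdeg]; exact hlow (q+1)) (hU0 _) (t j) ?_ (htroot j hj)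
    intro R hR _
    have := mL_pos μ hcarrier hinf ((C (t j) - X) * R ^ 2)
      (mul_ne_zero (by rw [← neg_sub, neg_ne_zero]; exact X_sub_C_ne_zero _) (pow_ne_zero 2 hR))
      (fun x _ hx => by
        simp only [eval_mul, eval_sub, eval_C, eval_X, eval_pow]
        exact mul_nonneg (by linarith) (sq_nonneg _))
    have e : (X - C (t j)) * R ^ 2 = -((C (t j) - X) * R ^ 2) := by ring
    rw [e, map_neg, neg_ne_zero]
    exact this.ne'
  have htgt : ∀ j ≤ q, -1 < t j := by
    intro j hj
    by_contra h
    refine no_root (U (q+1)) L (by rw [hdeg]; exact hlow (q+1)) (hU0 _) (t j) ?_ (htroot j hj)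
    intro R hR _
    exact (mL_pos μ hcarrier hinf ((X - C (t j)) * R ^ 2)
      (mul_ne_zero (X_sub_C_ne_zero _) (pow_ne_zero 2 hR))
      (fun x hx _ => by
        simp only [eval_mul, eval_sub, eval_C, eval_X, eval_pow]
        exact mul_nonneg (by linarith) (sq_nonneg _))).ne'
  obtain ⟨w, hw, hquad⟩ := quad μ hcarrier hinf q (U (q+1)) (hdeg _) (hlow (q+1)) t ht htroot
  obtain ⟨M, rfl⟩ := Nat.exists_eq_add_of_le hm
  have hinj : Set.InjOn t (Set.Iic (m + M)) := ht.injOn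
  have hS : Sys_s18 t w (m + M) U :=
    { anti := ht, wpos := hw, deg := fun l _ => hdeg l, lc := fun l _ => hlc l
      orth := fun l hl k hk hlk => by
        rw [← hquad, ← hL, horthL l k hlk]
        refine natDegree_mul_le.trans ?_
        rw [hdeg, hdeg]; omega }
  have hcone := main_cone_s18 m M t w U hS
  set G : ℝ[X] := ∏ j ∈ Finset.range (m + 1), (X - C (t j)) with hG
  set F : ℝ[X] := ∏ j ∈ Finset.range M, (X - C (t (m + 1 + j))) with hF
  have hGm : G.Monic := monic_prod_X_sub_C _ _
  have hFm : F.Monic := monic_prod_X_sub_C _ _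
  have hGd : G.natDegree = m + 1 := by rw [hG, natDegree_finsetProd_X_sub_C_eq_card]; simp
  have hFd : F.natDegree = M := by rw [hF, natDegree_finsetProd_X_sub_C_eq_card]; simp
  have hsplit : ∏ j ∈ Finset.range (m + 1 + M), (X - C (t j)) = G * F := Finset.prod_range_add _ _ _
  obtain ⟨a, ha, hUa⟩ : ∃ a : ℝ, 0 < a ∧ U (m + M + 1) = C a * (G * F) := by
    refine ⟨_, hlc (m + M + 1), ?_⟩
    have hdvd : G * F ∣ U (m + M + 1) := by
      rw [← hsplit]
      have := prod_dvd t (Finset.range (m + 1 + M))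
        (hinj.mono (fun x hx => by simp at hx ⊢; omega)) 1 (U (m + M + 1)) (fun j hj => by
          rw [pow_one]
          simp at hj
          exact dvd_iff_isRoot.2 (htroot j (by omega)))
      rwa [pow_one] at this
    have := eq_leadingCoeff_mul_of_monic_of_dvd_of_natDegree_le (hGm.mul hFm) hdvd (by
      rw [hdeg, hGm.natDegree_mul hFm, hGd, hFd]; omega)
    exact this
  have hFeq : ∀ j, m < j → j ≤ m + M → F.eval (t j) = 0 := by
    intro j h1 h2
    rw [hF, eval_prod]
    apply Finset.prod_eq_zero (i := j - (m+1)) (by simp; omega)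
    simp
    rw [show m + 1 + (j - (m+1)) = j by omega]; simp
  have hGeq : ∀ j, j ≤ m → G.eval (t j) = 0 := by
    intro j h1
    rw [hG, eval_prod]
    apply Finset.prod_eq_zero (i := j) (by simp; omega)
    simp
  have hGsign : ∀ s, (-1 : ℝ) ^ (m + 1) * G.eval s = ∏ j ∈ Finset.range (m + 1), (t j - s) := by
    intro s
    rw [hG, eval_prod]
    have : ((-1 : ℝ) ^ (m + 1)) = ∏ j ∈ Finset.range (m + 1), (-1 : ℝ) := by simp
    rw [this, ← Finset.prod_mul_distrib]
    apply Finset.prod_congr rfl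
    intro j _
    simp
  have htle : ∀ j ≤ m, t m ≤ t j := fun j hj =>
    ht.antitoneOn (by simp; omega) (by simp) hj
  have hsignne : ((-1 : ℝ) ^ (m + 1)) ≠ 0 := pow_ne_zero _ (by norm_num)
  set ps : ℝ[X] := C a * (U (m + M + 1) * F) with hps
  have hps' : ps = C (a ^ 2) * (G * F ^ 2) := by
    rw [hps, hUa, C_pow]; ring
  have hps0 : ps ≠ 0 := by
    rw [hps']
    exact mul_ne_zero (by simpa using ha.ne') (hGm.mul (hFm.pow 2)).ne_zero
  have hpsd : ps.natDegree ≤ n := by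
    rw [hps']
    refine (natDegree_C_mul_le _ _).trans ?_
    rw [hGm.natDegree_mul (hFm.pow 2), hFm.natDegree_pow, hGd, hFd]; omega
  have hpsev : ∀ j ≤ m + M, ps.eval (t j) = 0 := by
    intro j hj
    rw [hps]; simp [htroot j hj]
  have hpsint : ∀ g : ℝ[X], g.natDegree ≤ m → L (ps * g) = 0 := by
    intro g hg
    rw [hL, hquad _ (natDegree_mul_le.trans (by omega)), dL_apply]
    apply Finset.sum_eq_zero
    intro j hj
    simp at hj
    simp [hpsev j (by omega)]
  have hmomL : ∀ i (p : ℝ[X]), moment μ i p = L (p * X ^ i) := by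
    intro i p
    rw [hL, mL_apply, moment]; simp [mul_comm]
  have hacL : ∀ i (p : ℝ[X]), aCoef μ U i p = L (p * U i) := by
    intro i p
    rw [hL, mL_apply, aCoef]; simp
  have hpspi : PiPlus μ U ps := by
    intro l
    have key : ∀ f, InCone U (m + M) f → 0 ≤ L (U (m + M + 1) * f * U l) := by
      intro f hf
      induction hf with
      | zero => simp
      | basis k hk =>
        rw [← hacL]; exact hKrein _ _ l
      | add f g _ _ h1 h2 =>
        rw [mul_add, add_mul, map_add]; exact add_nonneg h1 h2
      | smul c hc f _ h1 =>
        rw [mul_left_comm, mul_assoc, ← smul_eq_C_mul, map_smul]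
        exact mul_nonneg hc h1
    rw [hacL, hps, mul_assoc, ← smul_eq_C_mul, map_smul]
    exact mul_nonneg ha.le (key F hcone)
  have hpsK : ps ∈ Kset μ U n m := by
    refine ⟨hpsd, hpspi, fun i hi => ?_, ?_⟩
    · rw [hmomL, hpsint]; rw [natDegree_X_pow]; omega
    · rw [hmomL, hpsint]; rw [natDegree_X_pow]
  have hpsval : ∀ s, (-1 : ℝ) ^ (m + 1) * ps.eval s =
      (∏ j ∈ Finset.range (m + 1), (t j - s)) * (a * F.eval s) ^ 2 := by
    intro s
    rw [← hGsign, hps']; simp; ring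
  have hpssign : ∀ s : ℝ, -1 ≤ s → s ≤ t m → 0 ≤ (-1 : ℝ) ^ (m + 1) * ps.eval s := by
    intro s _ hs
    rw [hpsval]
    refine mul_nonneg (Finset.prod_nonneg (fun j hj => ?_)) (sq_nonneg _)
    simp at hj
    have := htle j (by omega)
    linarith
  -- uniqueness
  have huniq : ∀ p ∈ Kset μ U n m, p ≠ 0 →
        (∀ s : ℝ, -1 ≤ s → s ≤ t m → 0 ≤ (-1 : ℝ) ^ (m + 1) * p.eval s) →
        ∃ c : ℝ, 0 < c ∧ p = C c * ps := by
    rintro p ⟨hpd, -, hmom0, hmomm⟩ hp0 hpsgn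
    -- vanishing at the small nodes
    set g : ℝ[X] := ∏ j ∈ Finset.range m, (X - C (t j)) with hg
    have hgm : g.Monic := monic_prod_X_sub_C _ _
    have hgd : g.natDegree = m := by rw [hg, natDegree_finsetProd_X_sub_C_eq_card]; simp
    have h1 := moment_pairing μ hcarrier p m hmom0 g hgd.le
    have hgc : g.coeff m = 1 := by
      have := hgm.coeff_natDegree
      rwa [hgd] at this
    rw [hgc, one_mul, hquad _ (natDegree_mul_le.trans (by omega)), dL_apply] at h1
    have hterm : ∀ j ∈ Finset.range (m + M + 1), w j * (p * g).eval (t j) ≤ 0 := by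
      intro j hj
      simp only [Finset.mem_range] at hj
      rcases lt_or_ge j m with h | h
      · have : g.eval (t j) = 0 := by
          rw [hg, eval_prod]
          exact Finset.prod_eq_zero (i := j) (by simpa using h) (by simp)
        simp [this]
      · have hgs : (-1 : ℝ) ^ m * g.eval (t j) = ∏ i ∈ Finset.range m, (t i - t j) := by
          rw [hg, eval_prod]
          have : ((-1 : ℝ) ^ m) = ∏ j ∈ Finset.range m, (-1 : ℝ) := by simp
          rw [this, ← Finset.prod_mul_distrib]
          apply Finset.prod_congr rfl
          intro j _
          simp
        have hgp : 0 ≤ (-1 : ℝ) ^ m * g.eval (t j) := by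
          rw [hgs]
          apply Finset.prod_nonneg
          intro i hi
          simp at hi
          exact sub_nonneg.2 (ht (by simp; omega) (by simp; omega) (by omega)).le
        have hpp := hpsgn (t j) (htgt j (by omega)).le
          (ht.antitoneOn (by simp) (by simp; omega) h)
        have hmul := mul_nonneg (hw j (by omega)).le (mul_nonneg hpp hgp)
        have e1 : ((-1 : ℝ) ^ m) * (-1) ^ m = 1 := by
          rw [← mul_pow]; simp
        have e2 : w j * ((-1 : ℝ) ^ (m + 1) * eval (t j) p * ((-1) ^ m * eval (t j) g))
            = - (w j * (p * g).eval (t j)) := by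
          rw [eval_mul, pow_succ]
          linear_combination (-(w j * eval (t j) p * eval (t j) g)) * e1
        linarith
    have hsum0 : ∑ j ∈ Finset.range (m + M + 1), w j * (p * g).eval (t j) = 0 :=
      le_antisymm (Finset.sum_nonpos hterm) (by rw [h1]; exact hmomm)
    have hmm : moment μ m p = 0 := by rw [← h1, hsum0]
    have hz1 : ∀ j, m ≤ j → j ≤ m + M → p.eval (t j) = 0 := by
      intro j hj1 hj2
      have := (Finset.sum_eq_zero_iff_of_nonpos hterm).1 hsum0 j (by simp; omega)
      rw [eval_mul] at this
      have hge : g.eval (t j) ≠ 0 := by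
        rw [hg, eval_prod, Finset.prod_ne_zero_iff]
        intro i hi
        simp at hi
        simp only [eval_sub, eval_X, eval_C]
        exact (sub_neg.2 (ht (by simp; omega) (by simp; omega) (by omega))).ne
      simpa [hge, (hw j hj2).ne'] using this
    have hz2 : ∀ k, k < m → p.eval (t k) = 0 := by
      intro k hk
      set r : ℝ[X] := ∏ j ∈ (Finset.range m).erase k, (X - C (t j)) with hr
      have hrd : r.natDegree = m - 1 := by
        rw [hr, natDegree_finsetProd_X_sub_C_eq_card, Finset.card_erase_of_mem (by simpa using hk)]
        simp
      have h2 := moment_pairing μ hcarrier p m hmom0 r (by omega)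
      rw [hmm, mul_zero, hquad _ (natDegree_mul_le.trans (by omega)), dL_apply,
        Finset.sum_eq_single k] at h2
      · have hre : r.eval (t k) ≠ 0 := by
          rw [hr, eval_prod, Finset.prod_ne_zero_iff]
          intro i hi
          simp at hi
          simp only [eval_sub, eval_X, eval_C]
          intro h
          exact hi.1 (hinj (by simp; omega) (by simp; omega) (sub_eq_zero.1 h).symm)
        simpa [hre, (hw k (by omega)).ne'] using h2
      · intro j hj hjk
        simp only [Finset.mem_range] at hj
        rcases lt_or_ge j m with h | h
        · have : r.eval (t j) = 0 := by
            rw [hr, eval_prod]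
            exact Finset.prod_eq_zero (i := j) (by simp [hjk, h]) (by simp)
          simp [this]
        · simp [hz1 j h (by omega)]
      · intro h; simp at h; omega
    have hz : ∀ j ≤ m + M, p.eval (t j) = 0 := fun j hj => by
      rcases lt_or_ge j m with h | h
      · exact hz2 j h
      · exact hz1 j h hj
    have hGdvd : G ∣ p := by
      have := prod_dvd t (Finset.range (m + 1))
        (hinj.mono (fun x hx => by simp at hx ⊢; omega)) 1 p (fun j hj => by
          rw [pow_one]
          simp at hj
          exact dvd_iff_isRoot.2 (hz j (by omega)))
      rwa [pow_one] at this
    have hFdvd : F ^ 2 ∣ p := by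
      refine prod_dvd (fun j => t (m + 1 + j)) (Finset.range M) ?_ 2 p (fun j hj => ?_)
      · intro x hx y hy hxy
        simp at hx hy
        have := hinj (by simp; omega) (by simp; omega) hxy
        omega
      · simp at hj
        exact double_root p _ (-1) (t m) _ hsignne hpsgn (htgt _ (by omega))
          (ht (by simp) (by simp; omega) (by omega)) (hz _ (by omega))
    have hcop : IsCoprime G (F ^ 2) := by
      apply IsCoprime.pow_right
      apply IsCoprime.prod_left
      intro i hi
      apply IsCoprime.prod_right
      intro j hj
      simp at hi hj
      apply isCoprime_X_sub_C_of_isUnit_sub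
      refine (sub_ne_zero.2 (fun h => ?_)).isUnit
      have := hinj (by simp; omega) (by simp; omega) h
      omega
    have hdvd := hcop.mul_dvd hGdvd hFdvd
    have hpe := eq_leadingCoeff_mul_of_monic_of_dvd_of_natDegree_le (hGm.mul (hFm.pow 2)) hdvd (by
      rw [hGm.natDegree_mul (hFm.pow 2), hFm.natDegree_pow, hGd, hFd]; omega)
    have hpc : p = C (p.leadingCoeff / a ^ 2) * ps := by
      rw [hps', ← mul_assoc, ← C_mul, div_mul_cancel₀ _ (by positivity)]
      exact hpe
    refine ⟨p.leadingCoeff / a ^ 2, ?_, hpc⟩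
    set c := p.leadingCoeff / a ^ 2 with hc
    have hc0 : c ≠ 0 := div_ne_zero (leadingCoeff_ne_zero.2 hp0) (by positivity)
    have h3 := hpsgn (-1) le_rfl (htgt m (by omega)).le
    rw [hpc, eval_mul, eval_C, mul_left_comm, hpsval] at h3
    have h4 : 0 < (∏ j ∈ Finset.range (m + 1), (t j - -1)) * (a * F.eval (-1)) ^ 2 := by
      apply mul_pos
      · apply Finset.prod_pos
        intro j hj
        simp at hj
        have := htgt j (by omega)
        linarith
      · have : F.eval (-1) ≠ 0 := by
          rw [hF, eval_prod, Finset.prod_ne_zero_iff]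
          intro j hj
          simp at hj
          simp only [eval_sub, eval_X, eval_C]
          have := htgt (m + 1 + j) (by omega)
          exact (sub_neg.2 this).ne
        positivity
    exact lt_of_le_of_ne (nonneg_of_mul_nonneg_left h3 h4) hc0.symm
  refine ⟨?_, ps, ?_, hpsK, hps0, hpssign, ?_, huniq⟩
  · have hgr : IsGreatest {x : ℝ | ∃ p ∈ Kset μ U n m, p ≠ 0 ∧ -1 ≤ x ∧ x ≤ 1 ∧
        ∀ s : ℝ, -1 ≤ s → s ≤ x → 0 ≤ (-1 : ℝ) ^ (m + 1) * p.eval s} (t m) := by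
      refine ⟨⟨ps, hpsK, hps0, (htgt m (by omega)).le, (htlt m (by omega)).le, hpssign⟩, ?_⟩
      rintro x ⟨p, hpK, hp0, -, -, hx⟩
      by_contra hlt
      have hlt := not_le.1 hlt
      obtain ⟨c, hc, hpc⟩ := huniq p hpK hp0 (fun s h1 h2 => hx s h1 (h2.trans hlt.le))
      have hd := double_root p _ (-1) x (t m) hsignne hx (htgt m (by omega)) hlt
        (by rw [hpc]; simp [hpsev m (by omega)])
      have he : p = (X - C (t m)) *
          (C (c * a ^ 2) * ((∏ j ∈ Finset.range m, (X - C (t j))) * F ^ 2)) := by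
        rw [hpc, hps', hG, Finset.prod_range_succ, C_mul]; ring
      rw [he, pow_two] at hd
      have hd := (mul_dvd_mul_iff_left (X_sub_C_ne_zero (t m))).1 hd
      have hd := dvd_iff_isRoot.1 hd
      simp only [IsRoot, eval_mul, eval_C, eval_pow] at hd
      have h1 : eval (t m) (∏ j ∈ Finset.range m, (X - C (t j))) ≠ 0 := by
        rw [eval_prod, Finset.prod_ne_zero_iff]
        intro i hi
        simp at hi
        simp only [eval_sub, eval_X, eval_C]
        exact (sub_neg.2 (ht (by simp; omega) (by simp) (by omega))).ne
      have h2 : eval (t m) F ≠ 0 := by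
        rw [hF, eval_prod, Finset.prod_ne_zero_iff]
        intro i hi
        simp at hi
        simp only [eval_sub, eval_X, eval_C]
        exact (sub_pos.2 (ht (by simp) (by simp; omega) (by omega))).ne'
      exact mul_ne_zero (mul_pos hc (by positivity)).ne' (mul_ne_zero h1 (pow_ne_zero 2 h2)) hd
    exact hgr.csSup_eq
  · rw [hps', hUa, C_pow]; ring
  · rw [hacL, hpsint]; rw [hdeg]

end DiscPaper
end
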